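/- Set I_Q = (I, T·I_L) ⊂ R[T]. Then: (i) dim R[T]/I_Q = d + 1 and depth R[T]/I_Q = d; (ii) for all m ≥ 0, HF(m, R[T]/I_Q) = HF(m, k[D]) + Σ_{j=1}^{m} HF(m−j, R/I_L); (iii) if t ≤ d then the sequence T − f_1, f_2, …, f_t is an R[T]/I_Q-regular sequence. -/

import Mathlib

open MvPolynomial

set_option synthInstance.maxHeartbeats 1000000
set_option maxHeartbeats 1000000

noncomputable section

namespace SRWLP

variable (k : Type) [Field k]

/-- An (abstract) simplicial complex on the vertex set `Fin n`:
a collection of finite subsets (faces) closed under passing to subsets. -/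
structure SC (n : ℕ) where
  faces : Finset (Finset (Fin n))
  down_closed : ∀ s ∈ faces, ∀ t ⊆ s, t ∈ faces

variable {n : ℕ}

/-- `dimP D = dim D + 1`, i.e. the maximal cardinality of a face of `D`. -/
def dimP (D : SC n) : ℕ := D.faces.sup Finset.card

/-- The Stanley–Reisner ideal of `D`: the ideal generated by the squarefree
monomials corresponding to non-faces. -/
def srIdeal (D : SC n) : Ideal (MvPolynomial (Fin n) k) :=
  Ideal.span { p | ∃ s : Finset (Fin n), s ∉ D.faces ∧ p = ∏ i ∈ s, X i }

/-- `x_σ`, the product of the variables indexed by the face `σ`. -/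
def xFace (σ : Finset (Fin n)) : MvPolynomial (Fin n) k := ∏ i ∈ σ, X i

variable {ι : Type} [Fintype ι]

/-- The degree-`m` graded component of the standard graded algebra
`k[Xᵢ : i ∈ ι] ⧸ J`, as a `k`-submodule. -/
def qComp (J : Ideal (MvPolynomial ι k)) (m : ℕ) :
    Submodule k (MvPolynomial ι k ⧸ J) :=
  (homogeneousSubmodule ι k m).map (Ideal.Quotient.mkₐ k J).toLinearMap

/-- Graded components indexed by `ℤ` (zero in negative degrees). -/
def qCompZ (J : Ideal (MvPolynomial ι k)) (m : ℤ) :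
    Submodule k (MvPolynomial ι k ⧸ J) :=
  if 0 ≤ m then qComp k J m.toNat else ⊥

/-- The Hilbert function of `k[Xᵢ] ⧸ J`. -/
def HFq (J : Ideal (MvPolynomial ι k)) (m : ℕ) : ℕ := Module.finrank k (qComp k J m)

/-- The Hilbert function, with `ℤ` argument. -/
def HFZ (J : Ideal (MvPolynomial ι k)) (m : ℤ) : ℕ := Module.finrank k (qCompZ k J m)

/-- A property `P` of tuples `c : τ → k` holds *generically* (i.e. for all choices
in a suitable nonempty Zariski-open subset of the affine space `k^τ`) if there is a
nonzero polynomial `g` such that `P c` holds whenever `g` does not vanish at `c`. -/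
def Generic (τ : Type) (P : (τ → k) → Prop) : Prop :=
  ∃ g : MvPolynomial τ k, g ≠ 0 ∧ ∀ c : τ → k, eval c g ≠ 0 → P c

/-- The linear form with coefficient tuple `c`. -/
def linForm (c : ι → k) : MvPolynomial ι k := ∑ i, C (c i) * X i

/-- The ideal `J` together with the `d` linear forms encoded by `c`. -/
def redIdeal (J : Ideal (MvPolynomial ι k)) {d : ℕ} (c : Fin d × ι → k) :
    Ideal (MvPolynomial ι k) :=
  J ⊔ Ideal.span (Set.range fun j : Fin d => linForm k fun i => c (j, i))

/-- `depth (k[Xᵢ]⧸J) ≥ t` : there is a regular sequence of length `t` consisting of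
elements of the graded maximal ideal. -/
def depthGE (J : Ideal (MvPolynomial ι k)) (t : ℕ) : Prop :=
  ∃ rs : List (MvPolynomial ι k), rs.length = t ∧
    (∀ f ∈ rs, f ∈ Ideal.span (Set.range (X : ι → MvPolynomial ι k))) ∧
    RingTheory.Sequence.IsRegular (MvPolynomial ι k ⧸ J)
      (rs.map (Ideal.Quotient.mk J))

/-- `k[Xᵢ]⧸J` is Cohen–Macaulay of Krull dimension `d`. -/
def isCM (J : Ideal (MvPolynomial ι k)) (d : ℕ) : Prop :=
  ringKrullDim (MvPolynomial ι k ⧸ J) = (d : ℕ) ∧ depthGE k J d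

/-- The socle of `k[Xᵢ]⧸J` (the annihilator of the graded maximal ideal). -/
def socle (J : Ideal (MvPolynomial ι k)) : Submodule k (MvPolynomial ι k ⧸ J) :=
  ⨅ i : ι, LinearMap.ker (LinearMap.mulLeft k (Ideal.Quotient.mk J (X i)))

/-- `k[Xᵢ]⧸J` is Artinian Gorenstein: Artinian with one-dimensional socle. -/
def artGor (J : Ideal (MvPolynomial ι k)) : Prop :=
  IsArtinianRing (MvPolynomial ι k ⧸ J) ∧ Module.finrank k (socle k J) = 1

/-- `k[Xᵢ]⧸J` is Gorenstein of Krull dimension `d`: it is Cohen–Macaulay of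
dimension `d` and a general Artinian reduction is Artinian Gorenstein. -/
def isGor (J : Ideal (MvPolynomial ι k)) (d : ℕ) : Prop :=
  isCM k J d ∧ Generic k (Fin d × ι) fun c => artGor k (redIdeal k J c)

/-- Multiplication by `ω` from the degree-`m` component to the degree-`(m+1)`
component of `k[Xᵢ]⧸J` has maximal rank (is injective or surjective). -/
def mulMaxRank (J : Ideal (MvPolynomial ι k)) (ω : MvPolynomial ι k ⧸ J) (m : ℕ) : Prop :=
  (∀ x ∈ qComp k J m, ω * x = 0 → x = 0) ∨
  (∀ y ∈ qComp k J (m + 1), ∃ x ∈ qComp k J m, ω * x = y)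

/-- The Weak Lefschetz Property for the Artinian algebra `k[Xᵢ]⧸J`: for a general
linear form `ω`, multiplication `ω : (⧸J)ₘ → (⧸J)ₘ₊₁` has maximal rank for all `m`. -/
def artWLP (J : Ideal (MvPolynomial ι k)) : Prop :=
  Generic k ι fun c => ∀ m : ℕ,
    mulMaxRank k J (Ideal.Quotient.mk J (linForm k c)) m

/-- The Weak Lefschetz Property for `k[Xᵢ]⧸J` of Krull dimension `d ≥ 1`:
Cohen–Macaulay, and a general Artinian reduction has the WLP. -/
def hasWLP (J : Ideal (MvPolynomial ι k)) (d : ℕ) : Prop :=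
  isCM k J d ∧ Generic k (Fin d × ι) fun c => artWLP k (redIdeal k J c)

/-- The Strong Lefschetz Property for the Artinian algebra `k[Xᵢ]⧸J`. -/
def artSLP (J : Ideal (MvPolynomial ι k)) : Prop :=
  ∃ r : ℕ, qComp k J r ≠ ⊥ ∧ (∀ j : ℕ, r < j → qComp k J j = ⊥) ∧
    (∀ i ≤ r, HFq k J i = HFq k J (r - i)) ∧
    Generic k ι fun c => ∀ i : ℕ, 2 * i ≤ r →
      (∀ x ∈ qComp k J i,
          Ideal.Quotient.mk J (linForm k c) ^ (r - 2 * i) * x = 0 → x = 0) ∧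
      (∀ y ∈ qComp k J (r - i), ∃ x ∈ qComp k J i,
          Ideal.Quotient.mk J (linForm k c) ^ (r - 2 * i) * x = y)

/-- The Strong Lefschetz Property for `k[Xᵢ]⧸J` of Krull dimension `d ≥ 1`. -/
def hasSLP (J : Ideal (MvPolynomial ι k)) (d : ℕ) : Prop :=
  isCM k J d ∧ Generic k (Fin d × ι) fun c => artSLP k (redIdeal k J c)

/-- `D` is Gorenstein* over `k`: every element of the vertex set is a vertex,
`k[D]` is Gorenstein (of dimension `dim D + 1`), and for every vertex `i` there is a
face `τ` with `τ ∪ {i}` not a face. -/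
def gorStar (D : SC n) : Prop :=
  (∀ i : Fin n, {i} ∈ D.faces) ∧
  isGor k (srIdeal k D) (dimP D) ∧
  (∀ i : Fin n, ∃ τ ∈ D.faces, insert i τ ∉ D.faces)

/-! `R[T]` is modelled as the polynomial ring in `n+1` variables, the last
variable playing the role of `T`. -/

/-- The inclusion `R = k[x₁,…,xₙ] → R[T] = k[x₁,…,xₙ,T]`. -/
def toT : MvPolynomial (Fin n) k →ₐ[k] MvPolynomial (Fin (n + 1)) k :=
  rename Fin.castSucc

/-- The variable `T` of `R[T]`. -/
def Tv (n : ℕ) : MvPolynomial (Fin (n + 1)) k := X (Fin.last n)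

/-- Extension of an ideal of `R` to `R[T]`. -/
def extI (J : Ideal (MvPolynomial (Fin n) k)) : Ideal (MvPolynomial (Fin (n + 1)) k) :=
  Ideal.map (toT k) J

/-- The ideal `T·J` of `R[T]`, for an ideal `J` of `R`. -/
def TmulI (J : Ideal (MvPolynomial (Fin n) k)) : Ideal (MvPolynomial (Fin (n + 1)) k) :=
  Ideal.span ((fun f => Tv k n * toT k f) '' (J : Set (MvPolynomial (Fin n) k)))

/-- `I_L = (I_D : x_σ)`, the Stanley–Reisner ideal of the link of `σ` in `D`
(extended to `R`). -/
def linkIdeal (D : SC n) (σ : Finset (Fin n)) : Ideal (MvPolynomial (Fin n) k) :=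
  Submodule.colon (srIdeal k D) (Ideal.span {xFace k σ})

/-- `J_st = (I, x_σ, T·I_L) ⊂ R[T]`, the Stanley–Reisner ideal of the stellar
subdivision `D_σ`. -/
def Jst (D : SC n) (σ : Finset (Fin n)) : Ideal (MvPolynomial (Fin (n + 1)) k) :=
  extI k (srIdeal k D) ⊔ Ideal.span {toT k (xFace k σ)} ⊔ TmulI k (linkIdeal k D σ)

/-- `I_C = (I, T^{q+1}, T·I_L) ⊂ R[T]`. -/
def IC (D : SC n) (σ : Finset (Fin n)) (q : ℕ) : Ideal (MvPolynomial (Fin (n + 1)) k) :=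
  extI k (srIdeal k D) ⊔ Ideal.span {Tv k n ^ (q + 1)} ⊔ TmulI k (linkIdeal k D σ)

/-- `I_G = (I, T^{q+1} - x_σ, T·I_L) ⊂ R[T]`. -/
def IG (D : SC n) (σ : Finset (Fin n)) (q : ℕ) : Ideal (MvPolynomial (Fin (n + 1)) k) :=
  extI k (srIdeal k D) ⊔ Ideal.span {Tv k n ^ (q + 1) - toT k (xFace k σ)} ⊔
    TmulI k (linkIdeal k D σ)

/-- The ideal of `R[T]` generated by `d` general linear forms of `R`
(involving only the `x`-variables). -/
def xForms {d : ℕ} (c : Fin d × Fin n → k) : Ideal (MvPolynomial (Fin (n + 1)) k) :=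
  Ideal.span (Set.range fun j : Fin d => toT k (linForm k fun i => c (j, i)))

/-- Property `M_{q,p₁}` for the Artinian algebra `B = R⧸J_B`: for a general linear
form `ω`, multiplication by `ω^q : B_{p₁-q} → B_{p₁}` is injective. -/
def propM (JB : Ideal (MvPolynomial (Fin n) k)) (q p₁ : ℕ) : Prop :=
  Generic k (Fin n) fun c => ∀ x ∈ qCompZ k JB ((p₁ : ℤ) - (q : ℤ)),
    Ideal.Quotient.mk JB (linForm k c) ^ q * x = 0 → x = 0

/-- `ModReg K l`: the list `l` is a weakly regular sequence on `A ⧸ K`, in elementary terms. -/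
def ModReg {A : Type*} [CommRing A] : Ideal A → List A → Prop
  | _, [] => True
  | K, f :: l => (∀ h, f * h ∈ K → h ∈ K) ∧ ModReg (K ⊔ Ideal.span {f}) l

section ModReg

variable {A B : Type*} [CommRing A] [CommRing B]

lemma mem_sup_span_singleton_iff {K : Ideal A} {f u : A} :
    u ∈ K ⊔ Ideal.span {f} ↔ ∃ a ∈ K, ∃ b, u = a + f * b := by
  rw [Submodule.mem_sup]
  constructor
  · rintro ⟨a, ha, y, hy, rfl⟩
    obtain ⟨b, rfl⟩ := Ideal.mem_span_singleton'.1 hy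
    exact ⟨a, ha, b, by ring⟩
  · rintro ⟨a, ha, b, rfl⟩
    exact ⟨a, ha, f * b, Ideal.mul_mem_right _ _ (Ideal.mem_span_singleton_self f), rfl⟩

lemma isSMulRegular_quotient_iff (K : Ideal A) (L : Ideal (A ⧸ K)) (f : A) :
    IsSMulRegular ((A ⧸ K) ⧸ (L • ⊤ : Submodule (A ⧸ K) (A ⧸ K))) (Ideal.Quotient.mk K f) ↔
      ∀ h, f * h ∈ L.comap (Ideal.Quotient.mk K) → h ∈ L.comap (Ideal.Quotient.mk K) := by
  rw [isSMulRegular_iff_right_eq_zero_of_smul]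
  have htop : (L • ⊤ : Submodule (A ⧸ K) (A ⧸ K)) = L := by simp
  constructor
  · intro H h hh
    have := H (Submodule.Quotient.mk (Ideal.Quotient.mk K h)) (by
      rw [← Submodule.Quotient.mk_smul, Submodule.Quotient.mk_eq_zero, htop]
      simpa using hh)
    rwa [Submodule.Quotient.mk_eq_zero, htop] at this
  · intro H x hx
    obtain ⟨y, rfl⟩ := Submodule.Quotient.mk_surjective _ x
    obtain ⟨h, rfl⟩ := Ideal.Quotient.mk_surjective y
    rw [← Submodule.Quotient.mk_smul, Submodule.Quotient.mk_eq_zero, htop] at hx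
    rw [Submodule.Quotient.mk_eq_zero, htop]
    exact H h (by simpa using hx)

lemma modReg_iff_forall (K : Ideal A) (l : List A) :
    ModReg K l ↔ ∀ i (hi : i < l.length), ∀ h,
      l[i] * h ∈ K ⊔ Ideal.ofList (l.take i) → h ∈ K ⊔ Ideal.ofList (l.take i) := by
  induction l generalizing K with
  | nil => simp [ModReg]
  | cons f l ih =>
    simp only [ModReg, ih]
    constructor
    · rintro ⟨h0, h1⟩ i hi
      cases i with
      | zero => simpa using h0
      | succ i =>
        simp only [List.length_cons, Nat.add_lt_add_iff_right] at hi
        simpa [sup_assoc] using h1 i hi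
    · intro H
      refine ⟨fun h hh => by simpa using H 0 (by simp) h (by simpa using hh),
        fun i hi h hh => ?_⟩
      simpa [sup_assoc] using H (i + 1) (by simpa using hi) h (by simpa [sup_assoc] using hh)

lemma isWeaklyRegular_iff_modReg (K : Ideal A) (l : List A) :
    RingTheory.Sequence.IsWeaklyRegular (A ⧸ K) (l.map (Ideal.Quotient.mk K)) ↔ ModReg K l := by
  rw [RingTheory.Sequence.isWeaklyRegular_iff, modReg_iff_forall]
  have key : ∀ i, (Ideal.ofList ((l.map (Ideal.Quotient.mk K)).take i)).comap
      (Ideal.Quotient.mk K) = K ⊔ Ideal.ofList (l.take i) := by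
    intro i
    rw [← List.map_take, ← Ideal.map_ofList,
      Ideal.comap_map_of_surjective _ Ideal.Quotient.mk_surjective, sup_comm,
      ← RingHom.ker_eq_comap_bot, Ideal.mk_ker]
  constructor
  · intro H i hi
    have := H i (by simpa using hi)
    rw [List.getElem_map, isSMulRegular_quotient_iff, key] at this
    exact this
  · intro H i hi
    rw [List.getElem_map, isSMulRegular_quotient_iff, key]
    exact H i (by simpa using hi)

lemma ModReg.take {K : Ideal A} {l : List A} (h : ModReg K l) (t : ℕ) :
    ModReg K (l.take t) := by
  induction l generalizing K t with
  | nil => simpa using h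
  | cons f l ih =>
    cases t with
    | zero => simp [ModReg]
    | succ t => exact ⟨h.1, ih h.2 t⟩

lemma modReg_append {K : Ideal A} {l l' : List A} :
    ModReg K (l ++ l') ↔ ModReg K l ∧ ModReg (K ⊔ Ideal.ofList l) l' := by
  induction l generalizing K with
  | nil => simp [ModReg]
  | cons f l ih => simp [ModReg, ih, and_assoc, sup_assoc]

lemma modReg_neg_cons {K : Ideal A} {f : A} {l : List A} (h : ModReg K (f :: l)) :
    ModReg K (-f :: l) := by
  refine ⟨fun x hx => h.1 x ?_, ?_⟩
  · rw [neg_mul] at hx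
    exact (neg_mem_iff).1 hx
  · rw [Ideal.span_singleton_neg]
    exact h.2

/-- Weak regularity passes to the intersection of two ideals, given it for both of them and for
their sum. -/
lemma ModReg.inf {K₁ K₂ : Ideal A} {l : List A} (h₁ : ModReg K₁ l) (h₂ : ModReg K₂ l)
    (h : ModReg (K₁ ⊔ K₂) l) : ModReg (K₁ ⊓ K₂) l := by
  induction l generalizing K₁ K₂ with
  | nil => trivial
  | cons f l ih =>
    refine ⟨fun x hx => ⟨h₁.1 x hx.1, h₂.1 x hx.2⟩, ?_⟩
    have e : (K₁ ⊓ K₂) ⊔ Ideal.span {f} = (K₁ ⊔ Ideal.span {f}) ⊓ (K₂ ⊔ Ideal.span {f}) := by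
      apply le_antisymm
      · exact sup_le (inf_le_inf le_sup_left le_sup_left) (le_inf le_sup_right le_sup_right)
      · rintro u ⟨hu₁, hu₂⟩
        obtain ⟨a, ha, b, rfl⟩ := mem_sup_span_singleton_iff.1 hu₁
        obtain ⟨a', ha', b', hb⟩ := mem_sup_span_singleton_iff.1 hu₂
        have hbb : b - b' ∈ K₁ ⊔ K₂ := by
          apply h.1
          have : f * (b - b') = -a + a' := by linear_combination hb
          rw [this]
          exact Submodule.add_mem_sup (neg_mem ha) ha'
        obtain ⟨c, hc, c', hc', hcc⟩ := Submodule.mem_sup.1 hbb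
        refine mem_sup_span_singleton_iff.2 ⟨a + f * c, ⟨?_, ?_⟩, b - c, by ring⟩
        · exact add_mem ha (Ideal.mul_mem_left _ _ hc)
        · have : a + f * c = a' - f * c' := by linear_combination hb + f * hcc
          rw [this]
          exact sub_mem ha' (Ideal.mul_mem_left _ _ hc')
    rw [e]
    refine ih h₁.2 h₂.2 ?_
    convert h.2 using 1
    rw [sup_sup_sup_comm, sup_idem]

lemma comap_sup_span_singleton {φ : A →+* B} (hφ : Function.Surjective φ) (K : Ideal B) (f : A) :
    K.comap φ ⊔ Ideal.span {f} = (K ⊔ Ideal.span {φ f}).comap φ := by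
  ext u
  rw [mem_sup_span_singleton_iff, Ideal.mem_comap, mem_sup_span_singleton_iff]
  constructor
  · rintro ⟨a, ha, b, rfl⟩
    exact ⟨φ a, ha, φ b, by simp⟩
  · rintro ⟨a, ha, b, hb⟩
    obtain ⟨b, rfl⟩ := hφ b
    refine ⟨u - f * b, ?_, b, by ring⟩
    rw [Ideal.mem_comap, map_sub, map_mul, hb, add_sub_cancel_right]
    exact ha

lemma modReg_comap_iff {φ : A →+* B} (hφ : Function.Surjective φ) (K : Ideal B) (l : List A) :
    ModReg (K.comap φ) l ↔ ModReg K (l.map φ) := by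
  induction l generalizing K with
  | nil => simp [ModReg]
  | cons f l ih =>
    simp only [ModReg, List.map_cons, comap_sup_span_singleton hφ, ih, Ideal.mem_comap, map_mul]
    refine and_congr_left fun _ => ⟨fun H h hh => ?_, fun H h hh => H _ hh⟩
    obtain ⟨h, rfl⟩ := hφ h
    exact H h hh

/-- Exchange of two elements forming a regular sequence: the second part. -/
lemma regular_exchange {K : Ideal A} {a y : A} (ha : ∀ h, a * h ∈ K → h ∈ K)
    (hy : ∀ h, y * h ∈ K ⊔ Ideal.span {a} → h ∈ K ⊔ Ideal.span {a}) :
    ∀ h, a * h ∈ K ⊔ Ideal.span {y} → h ∈ K ⊔ Ideal.span {y} := by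
  intro h hh
  obtain ⟨k, hk, c, hc⟩ := mem_sup_span_singleton_iff.1 hh
  have h1 : y * c ∈ K ⊔ Ideal.span {a} :=
    mem_sup_span_singleton_iff.2 ⟨-k, neg_mem hk, h, by linear_combination -hc⟩
  obtain ⟨k', hk', e, rfl⟩ := mem_sup_span_singleton_iff.1 (hy _ h1)
  have h2 : h - y * e ∈ K := by
    apply ha
    have : a * (h - y * e) = k + y * k' := by linear_combination hc
    rw [this]
    exact add_mem hk (Ideal.mul_mem_left _ _ hk')
  exact mem_sup_span_singleton_iff.2 ⟨h - y * e, h2, e, by ring⟩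

end ModReg

section Local

open IsLocalRing

variable {A : Type*} [CommRing A] [IsNoetherianRing A]

lemma mem_associatedPrimes_quotient_iff {K P : Ideal A} :
    P ∈ associatedPrimes A (A ⧸ K) ↔ P.IsPrime ∧ ∃ w, w ∉ K ∧ ∀ a, a ∈ P ↔ a * w ∈ K := by
  have hcolon : ∀ w a : A, a ∈ (⊥ : Submodule A (A ⧸ K)).colon {Ideal.Quotient.mk K w} ↔
      a * w ∈ K := by
    intro w a
    rw [Submodule.mem_colon_singleton, Submodule.mem_bot, Algebra.smul_def,
      Ideal.Quotient.algebraMap_eq, ← map_mul, Ideal.Quotient.eq_zero_iff_mem]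
  change (⊥ : Submodule A (A ⧸ K)).IsAssociatedPrime P ↔ _
  rw [Submodule.isAssociatedPrime_iff]
  refine and_congr_right fun hP => ⟨?_, ?_⟩
  · rintro ⟨w, hw⟩
    obtain ⟨w, rfl⟩ := Ideal.Quotient.mk_surjective w
    have hmem : ∀ a, a ∈ P ↔ a * w ∈ K := fun a => by rw [hw, hcolon]
    refine ⟨w, fun h => hP.ne_top ?_, hmem⟩
    rw [Ideal.eq_top_iff_one, hmem, one_mul]
    exact h
  · rintro ⟨w, -, hw⟩
    exact ⟨Ideal.Quotient.mk K w, Ideal.ext fun a => by rw [hw, hcolon]⟩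

/-- Every proper ideal `K : z` lies in an associated prime of `A ⧸ K`. -/
lemma exists_associatedPrime_of_notMem (K : Ideal A) (z : A) (hz : z ∉ K) :
    ∃ P ∈ associatedPrimes A (A ⧸ K), ∀ a, a * z ∈ K → a ∈ P := by
  have hz' : Ideal.Quotient.mk K z ≠ 0 := by rwa [Ne, Ideal.Quotient.eq_zero_iff_mem]
  obtain ⟨P, hP, hle⟩ := exists_le_isAssociatedPrime_of_isNoetherianRing A _ hz'
  refine ⟨P, hP, fun a ha => hle ?_⟩
  rw [Submodule.mem_colon_singleton, Submodule.mem_bot, Algebra.smul_def,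
    Ideal.Quotient.algebraMap_eq, ← map_mul, Ideal.Quotient.eq_zero_iff_mem]
  exact ha

variable [IsLocalRing A]

/-- Prime avoidance: a common regular element modulo finitely many ideals of positive depth. -/
lemma exists_regular_of_finite {s : Set (Ideal A)} (hs : s.Finite)
    (h : ∀ K ∈ s, ∀ z, (∀ a ∈ maximalIdeal A, a * z ∈ K) → z ∈ K) :
    ∃ y ∈ maximalIdeal A, ∀ K ∈ s, ∀ z, y * z ∈ K → z ∈ K := by
  have hfin : (⋃ K ∈ s, associatedPrimes A (A ⧸ K)).Finite :=
    hs.biUnion fun K _ => associatedPrimes.finite A (A ⧸ K)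
  by_contra! hcon
  have hsub : ((maximalIdeal A : Ideal A) : Set A) ⊆
      ⋃ P ∈ (hfin.toFinset : Set (Ideal A)), ((id P : Ideal A) : Set A) := by
    intro y hy
    obtain ⟨K, hK, z, hyz, hz⟩ := hcon y hy
    obtain ⟨P, hP, hPz⟩ := exists_associatedPrime_of_notMem K z hz
    simp only [Set.Finite.coe_toFinset, Set.mem_iUnion]
    exact ⟨P, ⟨K, hK, hP⟩, hPz y hyz⟩
  rw [Ideal.subset_union_prime ⊤ ⊤] at hsub
  · obtain ⟨P, hP, hle⟩ := hsub
    simp only [Set.Finite.mem_toFinset, Set.mem_iUnion] at hP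
    obtain ⟨K, hK, hP⟩ := hP
    obtain ⟨-, w, hw, hPw⟩ := mem_associatedPrimes_quotient_iff.1 hP
    exact hw (h K hK w fun a ha => (hPw a).1 (hle ha))
  · intro P hP _ _
    simp only [Set.Finite.mem_toFinset, Set.mem_iUnion] at hP
    obtain ⟨K, hK, hP⟩ := hP
    exact (mem_associatedPrimes_quotient_iff.1 hP).1

/-- Dividing out a regular element of the maximal ideal lowers the depth by at most one. -/
lemma exists_modReg_sup_span_singleton (l : List A) :
    ∀ (K : Ideal A) (a x : A), ModReg K (a :: l) → a ∈ maximalIdeal A →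
      (∀ b ∈ l, b ∈ maximalIdeal A) → x ∈ maximalIdeal A → (∀ h, x * h ∈ K → h ∈ K) →
      ∃ l' : List A, l'.length = l.length ∧ (∀ b ∈ l', b ∈ maximalIdeal A) ∧
        ModReg (K ⊔ Ideal.span {x}) l' := by
  induction hn : l.length generalizing l with
  | zero => exact fun K a x _ _ _ _ _ => ⟨[], rfl, by simp, trivial⟩
  | succ t ih =>
    intro K a x hK ha hl hx hxK
    obtain ⟨b, l, rfl⟩ := List.exists_cons_of_length_eq_add_one hn
    have hlen : l.length = t := by simpa using hn
    have hb : b ∈ maximalIdeal A := hl b (by simp)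
    have hl' : ∀ c ∈ l, c ∈ maximalIdeal A := fun c hc => hl c (by simp [hc])
    have h1 : ∀ z, (∀ c ∈ maximalIdeal A, c * z ∈ K ⊔ Ideal.span {a}) →
        z ∈ K ⊔ Ideal.span {a} := fun z hz => hK.2.1 z (hz b hb)
    have h2 : ∀ z, (∀ c ∈ maximalIdeal A, c * z ∈ K ⊔ Ideal.span {x}) →
        z ∈ K ⊔ Ideal.span {x} := by
      intro z hz
      obtain ⟨k, hk, w, hw⟩ := mem_sup_span_singleton_iff.1 (hz a ha)
      have hwa : w ∈ K ⊔ Ideal.span {a} := by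
        apply h1
        intro c hc
        obtain ⟨k', hk', u, hu⟩ := mem_sup_span_singleton_iff.1 (hz c hc)
        have : c * w - a * u ∈ K := by
          apply hxK
          have : x * (c * w - a * u) = a * k' - c * k := by
            linear_combination a * hu - c * hw
          rw [this]
          exact sub_mem (Ideal.mul_mem_left _ _ hk') (Ideal.mul_mem_left _ _ hk)
        exact mem_sup_span_singleton_iff.2 ⟨_, this, u, by ring⟩
      obtain ⟨k', hk', v, rfl⟩ := mem_sup_span_singleton_iff.1 hwa
      have : z - x * v ∈ K := by
        apply hK.1
        have : a * (z - x * v) = k + x * k' := by linear_combination hw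
        rw [this]
        exact add_mem hk (Ideal.mul_mem_left _ _ hk')
      exact mem_sup_span_singleton_iff.2 ⟨_, this, v, by ring⟩
    obtain ⟨y, hy, hyreg⟩ := exists_regular_of_finite
      (s := {K, K ⊔ Ideal.span {a}, K ⊔ Ideal.span {x}}) (by simp) (by
        rintro L (rfl | rfl | rfl)
        · exact fun z hz => hK.1 z (hz a ha)
        · exact h1
        · exact h2)
    have hyK := hyreg K (by simp)
    have hya := hyreg (K ⊔ Ideal.span {a}) (by simp)
    have hyx := hyreg (K ⊔ Ideal.span {x}) (by simp)
    obtain ⟨l₁, hl₁, hl₁m, hl₁r⟩ := ih l hlen (K ⊔ Ideal.span {a}) b y hK.2 hb hl' hy hya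
    obtain ⟨l₂, hl₂, hl₂m, hl₂r⟩ := ih l₁ hl₁ (K ⊔ Ideal.span {y}) a x
      ⟨regular_exchange hK.1 hya, by rwa [sup_right_comm] at hl₁r⟩ ha hl₁m hx
      (regular_exchange hxK hyx)
    refine ⟨y :: l₂, by simp [hl₂], ?_, hyx, by rwa [sup_right_comm] at hl₂r⟩
    rintro b hb
    rcases List.mem_cons.1 hb with rfl | hb
    exacts [hy, hl₂m b hb]

/-- The length of a regular sequence is bounded by the coheight of any associated prime. -/
lemma length_le_ringKrullDim_of_modReg (l : List A) :
    ∀ (K P : Ideal A), ModReg K l → (∀ b ∈ l, b ∈ maximalIdeal A) →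
      P ∈ associatedPrimes A (A ⧸ K) → (l.length : WithBot ℕ∞) ≤ ringKrullDim (A ⧸ P) := by
  induction l with
  | nil =>
    intro K P _ _ hP
    have hP' := (mem_associatedPrimes_quotient_iff.1 hP).1
    simpa using ringKrullDim_nonneg_of_nontrivial
  | cons x l ih =>
    intro K P hK hl hP
    obtain ⟨hPp, z, hz, hPz⟩ := mem_associatedPrimes_quotient_iff.1 hP
    have hx : x ∈ maximalIdeal A := hl x (by simp)
    have hxP : x ∉ P := fun h => hz (hK.1 z ((hPz x).1 h))
    let N : Ideal A :=
      { carrier := {v | ∀ p ∈ P, p * v ∈ K}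
        add_mem' := fun {u v} hu hv p hp => by
          rw [mul_add]; exact add_mem (hu p hp) (hv p hp)
        zero_mem' := fun p _ => by simp
        smul_mem' := fun c v hv p hp => by
          rw [smul_eq_mul, mul_left_comm]; exact Ideal.mul_mem_left _ _ (hv p hp) }
    have hN : ¬ N ≤ K ⊔ Ideal.span {x} := by
      intro hle
      have : N ≤ K := by
        refine Submodule.le_of_le_smul_of_le_jacobson_bot (I := Ideal.span {x})
          (IsNoetherian.noetherian N) ?_ ?_
        · rw [IsLocalRing.jacobson_eq_maximalIdeal _ bot_ne_top, Ideal.span_singleton_le_iff_mem]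
          exact hx
        · intro v hv
          obtain ⟨k, hk, m, rfl⟩ := mem_sup_span_singleton_iff.1 (hle hv)
          refine Submodule.add_mem_sup hk
            (Submodule.smul_mem_smul (Ideal.mem_span_singleton_self x) ?_)
          intro p hp
          apply hK.1
          have : x * (p * m) = p * (k + x * m) - p * k := by ring
          rw [this]
          exact sub_mem (hv p hp) (Ideal.mul_mem_left _ _ hk)
      exact hz (this fun p hp => (hPz p).1 hp)
    obtain ⟨v, hvN, hv⟩ := Set.not_subset.1 hN
    obtain ⟨Q, hQ, hQv⟩ := exists_associatedPrime_of_notMem _ v hv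
    have hle := ih _ Q hK.2 (fun b hb => hl b (by simp [hb])) hQ
    have hPQ : P ≤ Q := fun p hp => hQv p (Ideal.mem_sup_left (hvN p hp))
    have hxQ : x ∈ Q := hQv x (Ideal.mem_sup_right
      (Ideal.mul_mem_right _ _ (Ideal.mem_span_singleton_self x)))
    have hne : Ideal.Quotient.mk P x ≠ 0 := by rwa [Ne, Ideal.Quotient.eq_zero_iff_mem]
    have := ringKrullDim_succ_le_of_surjective (Ideal.Quotient.factor hPQ)
      (Ideal.Quotient.factor_surjective hPQ) (mem_nonZeroDivisors_of_ne_zero hne)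
      (by rw [Ideal.Quotient.factor_mk, Ideal.Quotient.eq_zero_iff_mem]; exact hxQ)
    refine le_trans ?_ this
    simp only [List.length_cons, Nat.cast_add, Nat.cast_one]
    gcongr

lemma ringKrullDim_quotient_le_length (P : Ideal A) [P.IsPrime] (f : List A)
    (hf : ∀ b ∈ f, b ∈ maximalIdeal A)
    (hQ : ∀ Q : Ideal A, Q.IsPrime → P ⊔ Ideal.ofList f ≤ Q → Q = maximalIdeal A) :
    ringKrullDim (A ⧸ P) ≤ f.length := by
  classical
  have : IsLocalRing (A ⧸ P) :=
    IsLocalRing.of_surjective' (Ideal.Quotient.mk P) Ideal.Quotient.mk_surjective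
  have hPm : P ≤ maximalIdeal A := IsLocalRing.le_maximalIdeal Ideal.IsPrime.ne_top'
  set s : Finset (A ⧸ P) := (f.map (Ideal.Quotient.mk P)).toFinset with hs
  have hcard : s.card ≤ f.length := by
    simpa using List.toFinset_card_le (f.map (Ideal.Quotient.mk P))
  have h0 : ringKrullDim ((A ⧸ P) ⧸ Ideal.span (s : Set (A ⧸ P))) ≤ 0 := by
    suffices Ring.KrullDimLE 0 ((A ⧸ P) ⧸ Ideal.span (s : Set (A ⧸ P))) from
      Ring.krullDimLE_iff.1 this
    refine Ring.KrullDimLE.mk₀ fun q hq => ?_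
    set φ := (Ideal.Quotient.mk (Ideal.span (s : Set (A ⧸ P)))).comp (Ideal.Quotient.mk P)
      with hφ
    have hφs : Function.Surjective φ :=
      Ideal.Quotient.mk_surjective.comp Ideal.Quotient.mk_surjective
    have hmax : q.comap φ = maximalIdeal A := by
      refine hQ _ (Ideal.comap_isPrime φ q) (sup_le ?_ ?_)
      · intro p hp
        rw [Ideal.mem_comap, hφ, RingHom.comp_apply, Ideal.Quotient.eq_zero_iff_mem.2 hp, map_zero]
        exact zero_mem q
      · refine Ideal.span_le.2 fun b hb => ?_
        rw [SetLike.mem_coe, Ideal.mem_comap, hφ, RingHom.comp_apply,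
          Ideal.Quotient.eq_zero_iff_mem.2]
        · exact zero_mem q
        · exact Ideal.subset_span (by simpa [hs] using ⟨b, hb, rfl⟩)
    rw [← Ideal.map_comap_of_surjective φ hφs q, hmax]
    refine (Ideal.map_eq_top_or_isMaximal_of_surjective φ hφs
      (IsLocalRing.maximalIdeal.isMaximal A)).resolve_left fun h => hq.ne_top ?_
    rw [← h, ← hmax, Ideal.map_comap_of_surjective φ hφs]
  have h1 := ringKrullDim_le_ringKrullDim_quotient_add_card s (by
    rw [IsLocalRing.ringJacobson_eq_maximalIdeal]
    intro c hc
    obtain ⟨b, hb, rfl⟩ : ∃ b ∈ f, Ideal.Quotient.mk P b = c := by simpa [hs] using hc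
    refine (IsLocalRing.mem_maximalIdeal _).2 fun hu => ?_
    obtain ⟨u, hu⟩ := isUnit_iff_exists_inv.1 hu
    obtain ⟨u, rfl⟩ := Ideal.Quotient.mk_surjective u
    rw [← map_mul, ← map_one (Ideal.Quotient.mk P), Ideal.Quotient.eq] at hu
    have h1 : (1 : A) ∈ maximalIdeal A := by
      have := sub_mem (Ideal.mul_mem_right u _ (hf b hb)) (hPm hu)
      simp at this
    exact (IsLocalRing.maximalIdeal.isMaximal A).ne_top ((Ideal.eq_top_iff_one _).2 h1))
  calc ringKrullDim (A ⧸ P) ≤ _ := h1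
    _ ≤ 0 + (f.length : WithBot ℕ∞) := by gcongr
    _ = _ := zero_add _

/-- In a quotient of depth at least `d`, a system of `d` parameters is a regular sequence. -/
lemma modReg_of_forall_prime (f : List A) :
    ∀ (K : Ideal A) (l : List A), ModReg K l → (∀ b ∈ l, b ∈ maximalIdeal A) →
      l.length = f.length → (∀ b ∈ f, b ∈ maximalIdeal A) →
      (∀ Q : Ideal A, Q.IsPrime → K ⊔ Ideal.ofList f ≤ Q → Q = maximalIdeal A) →
      ModReg K f := by
  induction f with
  | nil => exact fun _ _ _ _ _ _ _ => trivial
  | cons x f ih =>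
    intro K l hK hl hlen hf hQ
    obtain ⟨a, l, rfl⟩ := List.exists_cons_of_length_eq_add_one hlen
    have hx : x ∈ maximalIdeal A := hf x (by simp)
    have hf' : ∀ b ∈ f, b ∈ maximalIdeal A := fun b hb => hf b (by simp [hb])
    have hxreg : ∀ h, x * h ∈ K → h ∈ K := by
      intro h hh
      by_contra hhK
      obtain ⟨P, hP, hPh⟩ := exists_associatedPrime_of_notMem K h hhK
      have hdim := length_le_ringKrullDim_of_modReg _ K P hK hl hP
      obtain ⟨hPp, w, hw, hPw⟩ := mem_associatedPrimes_quotient_iff.1 hP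
      have hKP : K ≤ P := fun a ha => (hPw a).2 (Ideal.mul_mem_right _ _ ha)
      have hxP : x ∈ P := hPh x hh
      have hle := ringKrullDim_quotient_le_length P f hf' fun Q hQp hle => hQ Q hQp (by
        rw [Ideal.ofList_cons]
        refine sup_le (hKP.trans (le_sup_left.trans hle))
          (sup_le ?_ (le_sup_right.trans hle))
        rw [Ideal.span_singleton_le_iff_mem]
        exact hle (Ideal.mem_sup_left hxP))
      have := hdim.trans hle
      rw [hlen] at this
      have h2 : (x :: f).length ≤ f.length := by exact_mod_cast this
      simp at h2
    obtain ⟨l', hl', hl'm, hl'r⟩ := exists_modReg_sup_span_singleton l K a x hK (hl a (by simp))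
      (fun b hb => hl b (by simp [hb])) hx hxreg
    refine ⟨hxreg, ih _ l' hl'r hl'm (by simpa [hl'] using hlen) hf' fun Q hQp hle => hQ Q hQp ?_⟩
    rw [Ideal.ofList_cons, ← sup_assoc]
    exact hle

end Local

section Homogeneous

variable {k : Type} [Field k] {ι : Type}

/-- `HomI K`: the ideal `K` contains the homogeneous components of its elements. -/
def HomI (K : Ideal (MvPolynomial ι k)) : Prop :=
  ∀ p ∈ K, ∀ i, homogeneousComponent i p ∈ K

lemma homogeneousComponent_mul (p q : MvPolynomial ι k) (i : ℕ) :
    homogeneousComponent i (p * q) =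
      ∑ ij ∈ Finset.HasAntidiagonal.antidiagonal i,
        homogeneousComponent ij.1 p * homogeneousComponent ij.2 q := by
  let _ : GradedAlgebra (homogeneousSubmodule ι k) := MvPolynomial.gradedAlgebra
  have key : ∀ (r : MvPolynomial ι k) (j : ℕ),
      ((DirectSum.decompose (homogeneousSubmodule ι k) r) j : MvPolynomial ι k) =
        homogeneousComponent j r := fun r j => decomposition.decompose'_apply r j
  simp only [← key]
  rw [DirectSum.decompose_mul, DirectSum.coe_mul_apply_eq_sum_antidiagonal]

lemma HomI.sup {K L : Ideal (MvPolynomial ι k)} (hK : HomI K) (hL : HomI L) : HomI (K ⊔ L) := by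
  intro p hp i
  obtain ⟨a, ha, b, hb, rfl⟩ := Submodule.mem_sup.1 hp
  rw [map_add]
  exact add_mem (Ideal.mem_sup_left (hK a ha i)) (Ideal.mem_sup_right (hL b hb i))

lemma homI_span {s : Set (MvPolynomial ι k)} (hs : ∀ p ∈ s, ∃ m, p.IsHomogeneous m) :
    HomI (Ideal.span s) := by
  let _ : GradedAlgebra (homogeneousSubmodule ι k) := MvPolynomial.gradedAlgebra
  have h := Ideal.homogeneous_span (homogeneousSubmodule ι k) s
    fun x hx => (hs x hx).imp fun m hm => (mem_homogeneousSubmodule m x).2 hm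
  exact fun p hp i => homogeneousComponent_mem_of_mem h hp i

lemma homI_of_forall {K : Ideal (MvPolynomial ι k)} (S : Set (ι →₀ ℕ))
    (h : ∀ p, p ∈ K ↔ ∀ m ∈ p.support, m ∈ S) : HomI K := by
  intro p hp i
  rw [h] at hp ⊢
  intro m hm
  refine hp m ?_
  rw [mem_support_iff, coeff_homogeneousComponent] at hm
  rw [mem_support_iff]
  split_ifs at hm <;> simp_all

lemma HomI.mem_of_mul_mem {K : Ideal (MvPolynomial ι k)} (hK : HomI K) {s h : MvPolynomial ι k}
    (hs : constantCoeff s ≠ 0) (hsh : s * h ∈ K) : h ∈ K := by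
  have hcomp : ∀ i, homogeneousComponent i h ∈ K := by
    intro i
    induction i using Nat.strong_induction_on with
    | _ i ih =>
      have h1 := hK _ hsh i
      rw [homogeneousComponent_mul, Finset.sum_eq_sum_sdiff_singleton_add
        (show (0, i) ∈ Finset.HasAntidiagonal.antidiagonal i by simp)] at h1
      have h2 : ∑ x ∈ Finset.HasAntidiagonal.antidiagonal i \ {(0, i)},
          homogeneousComponent x.1 s * homogeneousComponent x.2 h ∈ K := by
        refine sum_mem fun x hx => K.mul_mem_left _ (ih _ ?_)
        obtain ⟨a, b⟩ := x
        simp only [Finset.mem_sdiff, Finset.HasAntidiagonal.mem_antidiagonal, Finset.mem_singleton,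
          Prod.mk.injEq] at hx
        grind
      have h3 := (Submodule.add_mem_iff_right _ h2).1 h1
      rw [homogeneousComponent_zero] at h3
      have h4 := K.mul_mem_left (C (constantCoeff s)⁻¹) h3
      rwa [← mul_assoc, ← C_mul, ← constantCoeff_eq, inv_mul_cancel₀ hs, C_1, one_mul] at h4
  rw [← sum_homogeneousComponent h]
  exact sum_mem fun i _ => hcomp i

end Homogeneous

section Localization

open IsLocalRing

variable {k : Type} [Field k] {ι : Type}

/-- The ideal of polynomials with vanishing constant coefficient. -/
def irr (k : Type) [Field k] (ι : Type) : Ideal (MvPolynomial ι k) :=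
  RingHom.ker (constantCoeff : MvPolynomial ι k →+* k)

lemma mem_irr {p : MvPolynomial ι k} : p ∈ irr k ι ↔ constantCoeff p = 0 := Iff.rfl

instance : (irr k ι).IsPrime := RingHom.ker_isPrime _

/-- The localization of the polynomial ring at the irrelevant ideal. -/
abbrev Loc (k : Type) [Field k] (ι : Type) : Type := Localization.AtPrime (irr k ι)

lemma mem_map_loc_iff {K : Ideal (MvPolynomial ι k)} {h : MvPolynomial ι k} :
    algebraMap _ (Loc k ι) h ∈ K.map (algebraMap _ (Loc k ι)) ↔
      ∃ s, constantCoeff s ≠ 0 ∧ s * h ∈ K :=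
  IsLocalization.algebraMap_mem_map_algebraMap_iff (irr k ι).primeCompl (Loc k ι) K h

lemma HomI.mem_map_loc_iff {K : Ideal (MvPolynomial ι k)} (hK : HomI K) {h : MvPolynomial ι k} :
    algebraMap _ (Loc k ι) h ∈ K.map (algebraMap _ (Loc k ι)) ↔ h ∈ K := by
  refine ⟨fun H => ?_, fun H => Ideal.mem_map_of_mem _ H⟩
  obtain ⟨s, hs, hsh⟩ := SRWLP.mem_map_loc_iff.1 H
  exact hK.mem_of_mul_mem hs hsh

lemma map_sup_span_singleton (K : Ideal (MvPolynomial ι k)) (f : MvPolynomial ι k) :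
    (K ⊔ Ideal.span {f}).map (algebraMap _ (Loc k ι)) =
      K.map (algebraMap _ (Loc k ι)) ⊔ Ideal.span {algebraMap _ (Loc k ι) f} := by
  rw [Ideal.map_sup, Ideal.map_span, Set.image_singleton]

lemma ModReg.map_loc {K : Ideal (MvPolynomial ι k)} {l : List (MvPolynomial ι k)}
    (h : ModReg K l) :
    ModReg (K.map (algebraMap _ (Loc k ι))) (l.map (algebraMap _ (Loc k ι))) := by
  induction l generalizing K with
  | nil => trivial
  | cons f l ih =>
    refine ⟨fun x hx => ?_, ?_⟩
    · obtain ⟨r, s, rfl⟩ := IsLocalization.exists_mk'_eq (irr k ι).primeCompl x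
      rw [IsLocalization.mk'_mem_iff]
      have h1 := Ideal.mul_mem_left _ (algebraMap (MvPolynomial ι k) (Loc k ι) s) hx
      rw [mul_left_comm, IsLocalization.mk'_spec', ← map_mul, mem_map_loc_iff] at h1
      obtain ⟨u, hu, hm⟩ := h1
      exact mem_map_loc_iff.2 ⟨u, hu, h.1 _ (by rwa [mul_left_comm])⟩
    · rw [← map_sup_span_singleton]
      exact ih h.2

lemma modReg_of_map_loc {K : Ideal (MvPolynomial ι k)} (hK : HomI K)
    {l : List (MvPolynomial ι k)} (hl : ∀ f ∈ l, f.IsHomogeneous 1)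
    (h : ModReg (K.map (algebraMap _ (Loc k ι))) (l.map (algebraMap _ (Loc k ι)))) :
    ModReg K l := by
  induction l generalizing K with
  | nil => trivial
  | cons f l ih =>
    refine ⟨fun x hx => ?_, ?_⟩
    · rw [← hK.mem_map_loc_iff]
      refine h.1 _ ?_
      rw [← map_mul]
      exact Ideal.mem_map_of_mem _ hx
    · refine ih (hK.sup (homI_span ?_)) (fun g hg => hl g (List.mem_cons_of_mem _ hg)) ?_
      · rintro p rfl
        exact ⟨1, hl _ List.mem_cons_self⟩
      · rw [map_sup_span_singleton]
        exact h.2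

lemma ringKrullDim_quotient_loc_le (I : Ideal (MvPolynomial ι k)) (P : Ideal (Loc k ι))
    (hI : ∀ a ∈ I, algebraMap _ (Loc k ι) a ∈ P) :
    ringKrullDim (Loc k ι ⧸ P) ≤ ringKrullDim (MvPolynomial ι k ⧸ I) := by
  rw [ringKrullDim_quotient, ringKrullDim_quotient]
  refine Order.krullDim_le_of_strictMono (fun Q => ⟨PrimeSpectrum.comap (algebraMap _ (Loc k ι)) Q.1,
    fun a ha => Q.2 (hI a ha)⟩) fun Q₁ Q₂ h => ?_
  have h' : Q₁.1.asIdeal < Q₂.1.asIdeal := h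
  change Q₁.1.asIdeal.comap _ < Q₂.1.asIdeal.comap _
  exact (IsLocalization.orderEmbedding (irr k ι).primeCompl (Loc k ι)).strictMono h'

variable [Finite ι]

omit [Finite ι] in
lemma algebraMap_mem_maximalIdeal {f : MvPolynomial ι k} (hf : constantCoeff f = 0) :
    algebraMap _ (Loc k ι) f ∈ maximalIdeal (Loc k ι) := by
  rw [← Localization.AtPrime.map_eq_maximalIdeal]
  exact Ideal.mem_map_of_mem _ hf

/-- On a homogeneous ideal with a regular sequence of length `e`, every system of `e` linear forms
with Artinian quotient is a regular sequence. -/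
theorem modReg_of_isArtinianRing {K K' : Ideal (MvPolynomial ι k)} (hK : HomI K)
    {l f : List (MvPolynomial ι k)} (hl : ModReg K l) (hl0 : ∀ b ∈ l, constantCoeff b = 0)
    (hlen : l.length = f.length) (hf : ∀ b ∈ f, b.IsHomogeneous 1)
    (hK' : K' ≤ K ⊔ Ideal.ofList f) (hA : IsArtinianRing (MvPolynomial ι k ⧸ K')) :
    ModReg K f := by
  have hf0 : ∀ b ∈ f, constantCoeff b = 0 := fun b hb => by
    rw [constantCoeff_eq]
    exact (hf b hb).coeff_eq_zero (by simp)
  refine modReg_of_map_loc hK hf (modReg_of_forall_prime _ _ _ hl.map_loc ?_ (by simpa) ?_ ?_)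
  · simpa using fun b hb => algebraMap_mem_maximalIdeal (hl0 b hb)
  · simpa using fun b hb => algebraMap_mem_maximalIdeal (hf0 b hb)
  · intro Q hQ hle
    rw [← Ideal.map_ofList, ← Ideal.map_sup, Ideal.map_le_iff_le_comap] at hle
    have hle' : K' ≤ Q.under (MvPolynomial ι k) := hK'.trans hle
    have := Ideal.isPrime_map_quotientMk_of_isPrime hle'
    have hmax := IsArtinianRing.isMaximal_of_isPrime
      ((Q.under (MvPolynomial ι k)).map (Ideal.Quotient.mk K'))
    have hmax' := Ideal.comap_isMaximal_of_surjective (Ideal.Quotient.mk K')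
      Ideal.Quotient.mk_surjective (K := (Q.under (MvPolynomial ι k)).map (Ideal.Quotient.mk K'))
    rw [Ideal.comap_map_mk hle'] at hmax'
    rw [← Localization.AtPrime.eq_maximalIdeal_iff_under_eq]
    refine hmax'.eq_of_le (inferInstance : (irr k ι).IsPrime).ne_top ?_
    have := Ideal.comap_mono (f := algebraMap (MvPolynomial ι k) (Loc k ι))
      (le_maximalIdeal hQ.ne_top)
    exact this.trans_eq Localization.AtPrime.under_maximalIdeal

/-- The length of a regular sequence modulo `K` is bounded by the dimension of the quotient by any
ideal annihilating an element which is nonzero in the localization of the quotient by `K`. -/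
theorem length_le_ringKrullDim_quotient {K I : Ideal (MvPolynomial ι k)}
    {l : List (MvPolynomial ι k)} (hl : ModReg K l) (hl0 : ∀ b ∈ l, constantCoeff b = 0)
    {z : MvPolynomial ι k} (hz : ∀ s, constantCoeff s ≠ 0 → s * z ∉ K)
    (hI : ∀ a ∈ I, a * z ∈ K) :
    (l.length : WithBot ℕ∞) ≤ ringKrullDim (MvPolynomial ι k ⧸ I) := by
  obtain ⟨P, hP, hPz⟩ := exists_associatedPrime_of_notMem (K.map (algebraMap _ (Loc k ι)))
    (algebraMap _ (Loc k ι) z) (fun h => by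
      obtain ⟨s, hs, hsz⟩ := mem_map_loc_iff.1 h
      exact hz s hs hsz)
  have h1 := length_le_ringKrullDim_of_modReg _ _ P hl.map_loc
    (by simpa using fun b hb => algebraMap_mem_maximalIdeal (hl0 b hb)) hP
  rw [List.length_map] at h1
  refine h1.trans (ringKrullDim_quotient_loc_le I P fun a ha => hPz _ ?_)
  rw [← map_mul]
  exact Ideal.mem_map_of_mem _ (hI a ha)

end Localization

section Variables

variable {k : Type} [Field k] {ι : Type}

/-- A variable which does not occur in the generators of an ideal is regular modulo the ideal. -/
lemma mem_span_of_X_mul_mem {s : Set (MvPolynomial ι k)} {v : ι} (hs : ∀ p ∈ s, v ∉ p.vars)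
    {h : MvPolynomial ι k} (hh : X v * h ∈ Ideal.span s) : h ∈ Ideal.span s := by
  classical
  have hfree : ∀ y : MvPolynomial ι k, v ∉ y.vars → y.divMonomial (Finsupp.single v 1) = 0 := by
    intro y hy
    ext m
    rw [coeff_divMonomial, coeff_zero]
    by_contra hne
    refine hy ((mem_vars_iff_mem_support v).2 ⟨_, mem_support_iff.2 hne, ?_⟩)
    simp [Finsupp.mem_support_iff]
  have hmod : ∀ a : MvPolynomial ι k, v ∉ (a.modMonomial (Finsupp.single v 1)).vars := by
    intro a ha
    obtain ⟨m, hm, hvm⟩ := (mem_vars_iff_mem_support v).1 ha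
    rw [mem_support_iff] at hm
    refine hm (coeff_modMonomial_of_le _ ?_)
    rw [Finsupp.single_le_iff]
    exact Nat.one_le_iff_ne_zero.2 (Finsupp.mem_support_iff.1 hvm)
  have key : ∀ u ∈ Ideal.span s, ∀ a, (a * u).divMonomial (Finsupp.single v 1) ∈ Ideal.span s := by
    intro u hu
    induction hu using Submodule.span_induction with
    | mem p hp =>
      intro a
      have e : a * p = X v * (a.divMonomial (Finsupp.single v 1) * p) +
          a.modMonomial (Finsupp.single v 1) * p := by
        conv_lhs => rw [← divMonomial_add_modMonomial_single a v]
        ring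
      rw [e, add_divMonomial, X_mul_divMonomial, hfree (_ * p), add_zero]
      · exact Ideal.mul_mem_left _ _ (Ideal.subset_span hp)
      · exact fun hv => (Finset.mem_union.1 (vars_mul _ _ hv)).elim (hmod a) (hs p hp)
    | zero => intro a; rw [mul_zero, zero_divMonomial]; exact zero_mem _
    | add x y _ _ hx hy => intro a; rw [mul_add, add_divMonomial]; exact add_mem (hx a) (hy a)
    | smul b p _ ih => intro a; rw [smul_eq_mul, ← mul_assoc]; exact ih _
  have := key _ hh 1
  rwa [one_mul, X_mul_divMonomial] at this

lemma mem_span_of_prod_X_mul_mem {s : Set (MvPolynomial ι k)} (t : Finset ι)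
    (hs : ∀ p ∈ s, ∀ v ∈ t, v ∉ p.vars) {h : MvPolynomial ι k}
    (hh : (∏ v ∈ t, X v) * h ∈ Ideal.span s) : h ∈ Ideal.span s := by
  classical
  induction t using Finset.induction_on generalizing h with
  | empty => simpa using hh
  | insert v t hv ih =>
    rw [Finset.prod_insert hv, mul_assoc] at hh
    exact ih (fun p hp w hw => hs p hp w (Finset.mem_insert_of_mem hw))
      (mem_span_of_X_mul_mem (fun p hp => hs p hp v (Finset.mem_insert_self v t)) hh)

lemma modReg_map_X {s : Set (MvPolynomial ι k)} {l : List ι} (hl : l.Nodup)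
    (hs : ∀ p ∈ s, ∀ v ∈ l, v ∉ p.vars) : ModReg (Ideal.span s) (l.map X) := by
  classical
  induction l generalizing s with
  | nil => trivial
  | cons v l ih =>
    rw [List.nodup_cons] at hl
    refine ⟨fun h => mem_span_of_X_mul_mem fun p hp => hs p hp v List.mem_cons_self, ?_⟩
    rw [sup_comm, ← Ideal.span_insert]
    refine ih hl.2 ?_
    rintro p (rfl | hp) w hw
    · rw [vars_X, Finset.mem_singleton]
      rintro rfl
      exact hl.1 hw
    · exact hs p hp w (List.mem_cons_of_mem _ hw)

/-- Transfer of regular sequences from `I` to an ideal `J ⊇ I` with `x_t J ⊆ I`, when the variables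
indexed by `t` occur neither in the generators of `J` nor in the sequence. -/
lemma modReg_of_prod_X_mul_mem (t : Finset ι) {s : Set (MvPolynomial ι k)}
    (hs : ∀ p ∈ s, ∀ v ∈ t, v ∉ p.vars) {g : List (MvPolynomial ι k)}
    (hg : ∀ p ∈ g, ∀ v ∈ t, v ∉ p.vars) {I : Ideal (MvPolynomial ι k)} (hI : I ≤ Ideal.span s)
    (hJ : ∀ p ∈ Ideal.span s, (∏ v ∈ t, X v) * p ∈ I) (h : ModReg I g) :
    ModReg (Ideal.span s) g := by
  induction g generalizing s I with
  | nil => trivial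
  | cons f g ih =>
    refine ⟨fun x hx => ?_, ?_⟩
    · have h1 := hJ _ hx
      rw [mul_left_comm] at h1
      exact mem_span_of_prod_X_mul_mem t hs (hI (h.1 _ h1))
    · have e : Ideal.span s ⊔ Ideal.span {f} = Ideal.span (insert f s) := by
        rw [sup_comm, ← Ideal.span_insert]
      have hI' : I ⊔ Ideal.span {f} ≤ Ideal.span (insert f s) := e ▸ sup_le_sup_right hI _
      rw [e]
      refine ih ?_ (fun p hp => hg p (List.mem_cons_of_mem _ hp)) hI' ?_ h.2
      · rintro p (rfl | hp)
        · exact hg p List.mem_cons_self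
        · exact hs p hp
      · intro p hp
        rw [← e, mem_sup_span_singleton_iff] at hp
        obtain ⟨a, ha, b, rfl⟩ := hp
        refine mem_sup_span_singleton_iff.2 ⟨_, hJ a ha, (∏ v ∈ t, X v) * b, by ring⟩

lemma mem_span_prod_X_iff {S : Set (Finset ι)} {p : MvPolynomial ι k} :
    p ∈ Ideal.span {p : MvPolynomial ι k | ∃ s, s ∈ S ∧ p = ∏ i ∈ s, X i} ↔
      ∀ m ∈ p.support, ∃ s ∈ S, s ⊆ m.support := by
  classical
  have e : {p : MvPolynomial ι k | ∃ s, s ∈ S ∧ p = ∏ i ∈ s, X i} =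
      (fun m => monomial m 1) '' ((fun s : Finset ι => ∑ i ∈ s, Finsupp.single i 1) '' S) := by
    ext p
    simp only [Set.mem_ofPred_eq, Set.mem_image, exists_exists_and_eq_and, monomial_sum_one]
    exact exists_congr fun s => and_congr_right fun _ => ⟨fun h => h.symm, fun h => h.symm⟩
  have hle : ∀ (s : Finset ι) (m : ι →₀ ℕ),
      ∑ i ∈ s, Finsupp.single i 1 ≤ m ↔ s ⊆ m.support := by
    intro s m
    have hc : ∀ j, (∑ i ∈ s, Finsupp.single i 1 : ι →₀ ℕ) j = if j ∈ s then 1 else 0 := by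
      intro j
      simp [Finsupp.finsetSum_apply, Finsupp.single_apply]
    rw [Finsupp.le_def]
    simp only [hc]
    constructor
    · intro h j hj
      have := h j
      rw [if_pos hj] at this
      exact Finsupp.mem_support_iff.2 (by omega)
    · intro h j
      split_ifs with hj
      · exact Nat.one_le_iff_ne_zero.2 (Finsupp.mem_support_iff.1 (h hj))
      · exact Nat.zero_le _
  rw [e, mem_ideal_span_monomial_image]
  simp [hle]

end Variables

section StanleyReisner

variable {k : Type} [Field k] {n : ℕ}

lemma mem_srIdeal_iff {D : SC n} {p : MvPolynomial (Fin n) k} :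
    p ∈ srIdeal k D ↔ ∀ m ∈ p.support, m.support ∉ D.faces := by
  refine (mem_span_prod_X_iff (S := {s | s ∉ D.faces})).trans (forall₂_congr fun m _ => ?_)
  exact ⟨fun ⟨s, hs, hsm⟩ h => hs (D.down_closed _ h _ hsm), fun h => ⟨_, h, subset_rfl⟩⟩

lemma mem_linkIdeal_iff_mul {D : SC n} {σ : Finset (Fin n)} {p : MvPolynomial (Fin n) k} :
    p ∈ linkIdeal k D σ ↔ xFace k σ * p ∈ srIdeal k D := by
  rw [linkIdeal, Submodule.mem_colon]
  constructor
  · intro h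
    rw [mul_comm]
    exact h _ (Ideal.mem_span_singleton_self _)
  · intro h y hy
    obtain ⟨b, rfl⟩ := Ideal.mem_span_singleton'.1 hy
    have := Ideal.mul_mem_left _ b h
    rwa [smul_eq_mul, mul_left_comm, mul_comm p]

lemma mem_linkIdeal_iff {D : SC n} {σ : Finset (Fin n)} {p : MvPolynomial (Fin n) k} :
    p ∈ linkIdeal k D σ ↔ ∀ m ∈ p.support, m.support ∪ σ ∉ D.faces := by
  have hsupp : ∀ m : Fin n →₀ ℕ,
      (∑ i ∈ σ, Finsupp.single i 1 + m).support = m.support ∪ σ := by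
    intro m
    ext j
    rw [Finsupp.mem_support_iff, Finset.mem_union, Finsupp.mem_support_iff]
    simp [Finsupp.single_apply]
    tauto
  have hx : xFace k σ = monomial (∑ i ∈ σ, Finsupp.single i 1) 1 := by
    rw [monomial_sum_one]
    rfl
  rw [mem_linkIdeal_iff_mul, mem_srIdeal_iff, hx]
  constructor
  · intro h m hm
    rw [← hsupp]
    refine h _ ?_
    rwa [mem_support_iff, coeff_monomial_mul, one_mul, ← mem_support_iff]
  · intro h m hm
    rw [mem_support_iff, coeff_monomial_mul'] at hm
    split_ifs at hm with hle
    · obtain ⟨m, rfl⟩ := exists_add_of_le hle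
      rw [hsupp]
      refine h m ?_
      rwa [add_tsub_cancel_left, one_mul, ← mem_support_iff] at hm
    · exact absurd rfl hm

lemma linkIdeal_eq_span {D : SC n} {σ : Finset (Fin n)} :
    linkIdeal k D σ =
      Ideal.span {p | ∃ s, s ∈ {s | Disjoint s σ ∧ s ∪ σ ∉ D.faces} ∧ p = ∏ i ∈ s, X i} := by
  ext p
  rw [mem_linkIdeal_iff, mem_span_prod_X_iff]
  refine forall₂_congr fun m _ => ⟨fun h => ⟨m.support \ σ, ⟨Finset.sdiff_disjoint, by simpa⟩,
    Finset.sdiff_subset⟩, ?_⟩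
  rintro ⟨s, ⟨-, hs⟩, hsm⟩ h
  exact hs (D.down_closed _ h _ (Finset.union_subset_union_left hsm))

lemma srIdeal_le_linkIdeal {D : SC n} {σ : Finset (Fin n)} : srIdeal k D ≤ linkIdeal k D σ :=
  fun _ hp => mem_linkIdeal_iff_mul.2 (Ideal.mul_mem_left _ _ hp)

lemma homI_srIdeal (D : SC n) : HomI (srIdeal k D) :=
  homI_of_forall {m | m.support ∉ D.faces} fun _ => mem_srIdeal_iff

lemma homI_linkIdeal (D : SC n) (σ : Finset (Fin n)) : HomI (linkIdeal k D σ) :=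
  homI_of_forall {m | m.support ∪ σ ∉ D.faces} fun _ => mem_linkIdeal_iff

lemma constantCoeff_of_mem_linkIdeal {D : SC n} {σ : Finset (Fin n)} (hσ : σ ∈ D.faces)
    {p : MvPolynomial (Fin n) k} (hp : p ∈ linkIdeal k D σ) : constantCoeff p = 0 := by
  by_contra h
  exact mem_linkIdeal_iff.1 hp 0 (mem_support_iff.2 h) (by simpa)

end StanleyReisner

section LinForm

variable {k : Type} [Field k] {ι : Type} [Fintype ι]

lemma isHomogeneous_linForm (c : ι → k) : (linForm k c).IsHomogeneous 1 :=
  IsHomogeneous.sum _ _ _ fun _ _ => isHomogeneous_C_mul_X _ _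

lemma notMem_vars_linForm {c : ι → k} {v : ι} (hv : c v = 0) : v ∉ (linForm k c).vars := by
  classical
  intro h
  obtain ⟨i, -, hi⟩ := Finset.mem_biUnion.1 (vars_sum_subset _ _ h)
  by_cases hci : c i = 0
  · simp [hci] at hi
  · rw [vars_C_mul _ hci, vars_X, Finset.mem_singleton] at hi
    exact hci (hi ▸ hv)

lemma linForm_sum {κ : Type} [Fintype κ] (a : κ → k) (c : κ → ι → k) :
    linForm k (∑ j, a j • c j) = ∑ j, C (a j) * linForm k (c j) := by
  simp only [linForm, Finset.sum_apply, Pi.smul_apply, smul_eq_mul, map_sum, map_mul,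
    Finset.sum_mul, Finset.mul_sum, mul_assoc]
  exact Finset.sum_comm

/-- Linear forms may be replaced, without changing the ideal they generate, by linear forms of
which all but at most `#t` do not involve the variables indexed by `t`. -/
lemma exists_linForms_free {d : ℕ} (c : Fin d → ι → k) (t : Finset ι) :
    ∃ g o : List (MvPolynomial ι k), (∀ p ∈ g ++ o, p.IsHomogeneous 1) ∧
      (∀ p ∈ g, ∀ v ∈ t, v ∉ p.vars) ∧ g.length + o.length = d ∧ o.length ≤ t.card ∧
      ∀ j, linForm k (c j) ∈ Ideal.ofList (g ++ o) := by
  classical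
  let F : (Fin d → k) →ₗ[k] (ι → k) := Fintype.linearCombination k c
  let L : (Fin d → k) →ₗ[k] (t → k) := (LinearMap.funLeft k k (Subtype.val : t → ι)).comp F
  obtain ⟨W, hW⟩ := L.ker.exists_isCompl
  let b₁ := Module.finBasis k L.ker
  let b₂ := Module.finBasis k W
  refine ⟨List.ofFn fun i => linForm k (F (b₁ i)), List.ofFn fun i => linForm k (F (b₂ i)),
    ?_, ?_, ?_, ?_, ?_⟩
  · intro p hp
    rw [List.mem_append, List.mem_ofFn', List.mem_ofFn'] at hp
    rcases hp with ⟨i, rfl⟩ | ⟨i, rfl⟩ <;> exact isHomogeneous_linForm _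
  · intro p hp v hv
    rw [List.mem_ofFn'] at hp
    obtain ⟨i, rfl⟩ := hp
    exact notMem_vars_linForm (congrFun (LinearMap.mem_ker.1 (b₁ i).2) ⟨v, hv⟩)
  · rw [List.length_ofFn, List.length_ofFn, Submodule.finrank_add_eq_of_isCompl hW]
    simp
  · rw [List.length_ofFn]
    have hinj : Function.Injective (L.domRestrict W) := by
      rw [← LinearMap.ker_eq_bot, LinearMap.ker_eq_bot']
      intro w hw
      exact Subtype.ext (Submodule.disjoint_def.1 hW.disjoint w.1 (LinearMap.mem_ker.2 hw) w.2)
    have := LinearMap.finrank_le_finrank_of_injective hinj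
    simpa using this
  · have hmem : ∀ (B : Ideal (MvPolynomial ι k)) (U : Submodule k (Fin d → k))
        (b : Module.Basis (Fin (Module.finrank k U)) k U),
        (∀ i, linForm k (F (b i)) ∈ B) → ∀ u ∈ U, linForm k (F u) ∈ B := by
      intro B U b hb u hu
      have h1 : u = ∑ i, b.repr ⟨u, hu⟩ i • (b i : Fin d → k) := by
        have h2 := congrArg U.subtype (b.sum_repr ⟨u, hu⟩)
        rw [map_sum] at h2
        exact h2.symm
      rw [h1, map_sum]
      simp only [map_smul]
      rw [linForm_sum]
      exact sum_mem fun i _ => B.mul_mem_left _ (hb i)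
    intro j
    have hj : c j = F (Pi.single j 1) := by
      simp [F, Fintype.linearCombination_apply, Pi.single_apply]
    have htop : (Pi.single j 1 : Fin d → k) ∈ L.ker ⊔ W := by
      rw [hW.sup_eq_top]; trivial
    obtain ⟨u, hu, w, hw, huw⟩ := Submodule.mem_sup.1 htop
    have hadd : linForm k (F (u + w)) = linForm k (F u) + linForm k (F w) := by
      simp [linForm, add_mul, Finset.sum_add_distrib]
    rw [hj, ← huw, hadd]
    refine add_mem (hmem _ _ b₁ (fun i => Ideal.subset_span ?_) u hu)
      (hmem _ _ b₂ (fun i => Ideal.subset_span ?_) w hw)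
    · exact List.mem_append_left _ ((List.mem_ofFn' _ _).2 ⟨i, rfl⟩)
    · exact List.mem_append_right _ ((List.mem_ofFn' _ _).2 ⟨i, rfl⟩)

end LinForm

section CohenMacaulay

variable {k : Type} [Field k] {n : ℕ}

lemma exists_modReg_of_depthGE {ι : Type} [Fintype ι] {K : Ideal (MvPolynomial ι k)} {t : ℕ}
    (h : depthGE k K t) :
    ∃ l : List (MvPolynomial ι k), l.length = t ∧ (∀ b ∈ l, constantCoeff b = 0) ∧ ModReg K l := by
  obtain ⟨l, hlen, hl, hreg⟩ := h
  refine ⟨l, hlen, fun b hb => ?_, (isWeaklyRegular_iff_modReg K l).1 hreg.toIsWeaklyRegular⟩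
  have hle : Ideal.span (Set.range (X : ι → MvPolynomial ι k)) ≤ irr k ι := by
    rw [Ideal.span_le]
    rintro _ ⟨i, rfl⟩
    exact constantCoeff_X _ i
  exact hle (hl b hb)

lemma redIdeal_eq_sup_ofList {ι : Type} [Fintype ι] (K : Ideal (MvPolynomial ι k)) {d : ℕ}
    (c : Fin d × ι → k) :
    redIdeal k K c = K ⊔ Ideal.ofList (List.ofFn fun j => linForm k fun i => c (j, i)) := by
  rw [redIdeal, Ideal.ofList]
  congr 2
  ext p
  simp [List.mem_ofFn', Set.mem_range]

variable {D : SC n} {σ : Finset (Fin n)}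

lemma exists_modReg_linkIdeal (hD : depthGE k (srIdeal k D) (dimP D))
    {c : Fin (dimP D) × Fin n → k}
    (hc : IsArtinianRing (MvPolynomial (Fin n) k ⧸ redIdeal k (srIdeal k D) c)) :
    ∃ l : List (MvPolynomial (Fin n) k), l.length = dimP D ∧ (∀ b ∈ l, constantCoeff b = 0) ∧
      ModReg (linkIdeal k D σ) l := by
  obtain ⟨l, hlen, hl0, hl⟩ := exists_modReg_of_depthGE hD
  obtain ⟨g, o, hhom, hfree, hgo, ho, hmem⟩ := exists_linForms_free (fun j i => c (j, i)) σ
  have hreg : ModReg (srIdeal k D) (g ++ o) := by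
    refine modReg_of_isArtinianRing (homI_srIdeal D) hl hl0 (by simp [hlen, hgo]) hhom ?_ hc
    rw [redIdeal]
    refine sup_le_sup_left (Ideal.span_le.2 ?_) _
    rintro _ ⟨j, rfl⟩
    exact hmem j
  have hg := (modReg_append.1 hreg).1
  set S : Set (MvPolynomial (Fin n) k) :=
    {p | ∃ s, s ∈ {s | Disjoint s σ ∧ s ∪ σ ∉ D.faces} ∧ p = ∏ i ∈ s, X i} with hS
  have hJ : linkIdeal k D σ = Ideal.span S := linkIdeal_eq_span
  have hSfree : ∀ p ∈ S, ∀ v ∈ σ, v ∉ p.vars := by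
    rintro _ ⟨s, ⟨hs, -⟩, rfl⟩ v hv hvp
    obtain ⟨i, hi, hvi⟩ := Finset.mem_biUnion.1 (vars_prod _ hvp)
    rw [vars_X, Finset.mem_singleton] at hvi
    exact Finset.disjoint_left.1 hs hi (hvi ▸ hv)
  have hgJ : ModReg (Ideal.span S) g := by
    refine modReg_of_prod_X_mul_mem σ hSfree hfree (I := srIdeal k D) ?_ ?_ hg
    · rw [← hJ]
      exact srIdeal_le_linkIdeal
    · intro p hp
      rw [← hJ] at hp
      exact mem_linkIdeal_iff_mul.1 hp
  have hJX : ModReg (Ideal.span S) (g ++ σ.toList.map X) := by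
    refine modReg_append.2 ⟨hgJ, ?_⟩
    rw [Ideal.ofList, ← Ideal.span_union]
    refine modReg_map_X σ.nodup_toList ?_
    rintro p (hp | hp) v hv
    · exact hSfree p hp v (Finset.mem_toList.1 hv)
    · exact hfree p hp v (Finset.mem_toList.1 hv)
  refine ⟨(g ++ σ.toList.map X).take (dimP D), ?_, ?_, hJ ▸ hJX.take _⟩
  · simp
    omega
  · intro b hb
    rcases List.mem_append.1 (List.mem_of_mem_take hb) with hb | hb
    · rw [constantCoeff_eq]
      exact (hhom b (List.mem_append_left _ hb)).coeff_eq_zero (by simp)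
    · obtain ⟨i, -, rfl⟩ := List.mem_map.1 hb
      exact constantCoeff_X _ i

/-- Every linear system of parameters of `k[D]` is a regular sequence on `k[D]`. -/
lemma modReg_srIdeal (hD : depthGE k (srIdeal k D) (dimP D)) {c : Fin (dimP D) × Fin n → k}
    (hc : IsArtinianRing (MvPolynomial (Fin n) k ⧸ redIdeal k (srIdeal k D) c)) :
    ModReg (srIdeal k D) (List.ofFn fun j => linForm k fun i => c (j, i)) := by
  obtain ⟨l, hlen, hl0, hl⟩ := exists_modReg_of_depthGE hD
  refine modReg_of_isArtinianRing (homI_srIdeal D) hl hl0 (by simp [hlen]) ?_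
    (redIdeal_eq_sup_ofList _ c).le hc
  intro b hb
  obtain ⟨j, rfl⟩ := (List.mem_ofFn' _ _).1 hb
  exact isHomogeneous_linForm _

/-- Every linear system of parameters of `k[D]` is a regular sequence modulo the link ideal. -/
lemma modReg_linkIdeal (hD : depthGE k (srIdeal k D) (dimP D)) {c : Fin (dimP D) × Fin n → k}
    (hc : IsArtinianRing (MvPolynomial (Fin n) k ⧸ redIdeal k (srIdeal k D) c)) :
    ModReg (linkIdeal k D σ) (List.ofFn fun j => linForm k fun i => c (j, i)) := by
  obtain ⟨l, hlen, hl0, hl⟩ := exists_modReg_linkIdeal (σ := σ) hD hc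
  refine modReg_of_isArtinianRing (homI_linkIdeal D σ) hl hl0 (by simp [hlen]) ?_
    ((redIdeal_eq_sup_ofList _ c).le.trans (sup_le_sup_right srIdeal_le_linkIdeal _)) hc
  intro b hb
  obtain ⟨j, rfl⟩ := (List.mem_ofFn' _ _).1 hb
  exact isHomogeneous_linForm _

end CohenMacaulay

section AdjoinVariable

variable {k : Type} [Field k] {n : ℕ}

/-- The retraction `R[T] → R` sending `T` to `a`. -/
def evalT (a : MvPolynomial (Fin n) k) : MvPolynomial (Fin (n + 1)) k →ₐ[k] MvPolynomial (Fin n) k :=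
  aeval (Fin.lastCases a X)

@[simp]
lemma evalT_toT (a p : MvPolynomial (Fin n) k) : evalT a (toT k p) = p := by
  have : (evalT a).comp (toT k) = AlgHom.id k _ := by
    ext i
    simp [evalT, toT]
  exact DFunLike.congr_fun this p

@[simp]
lemma evalT_Tv (a : MvPolynomial (Fin n) k) : evalT a (Tv k n) = a := by
  simp [evalT, Tv]

lemma evalT_surjective (a : MvPolynomial (Fin n) k) :
    Function.Surjective (evalT a : MvPolynomial (Fin (n + 1)) k →+* MvPolynomial (Fin n) k) :=
  fun p => ⟨toT k p, evalT_toT a p⟩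

lemma sub_toT_evalT_mem (a : MvPolynomial (Fin n) k) (p : MvPolynomial (Fin (n + 1)) k) :
    p - toT k (evalT a p) ∈ Ideal.span {Tv k n - toT k a} := by
  set L := Ideal.span {Tv k n - toT k a}
  have : (Ideal.Quotient.mkₐ k L) = ((Ideal.Quotient.mkₐ k L).comp (toT k)).comp (evalT a) := by
    ext i
    refine Fin.lastCases ?_ (fun i => ?_) i
    · change Ideal.Quotient.mk L (Tv k n) = Ideal.Quotient.mk L (toT k (evalT a (Tv k n)))
      rw [evalT_Tv, Ideal.Quotient.mk_eq_mk_iff_sub_mem]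
      exact Ideal.mem_span_singleton_self _
    · simp [evalT, toT]
  rw [← Ideal.Quotient.mk_eq_mk_iff_sub_mem]
  exact DFunLike.congr_fun this p

lemma extI_sup_span_singleton (K : Ideal (MvPolynomial (Fin n) k)) (a : MvPolynomial (Fin n) k) :
    extI k K ⊔ Ideal.span {Tv k n - toT k a} =
      K.comap (evalT a : MvPolynomial (Fin (n + 1)) k →+* MvPolynomial (Fin n) k) := by
  apply le_antisymm
  · refine sup_le (Ideal.map_le_iff_le_comap.2 fun p hp => ?_) ((Ideal.span_singleton_le_iff_mem _).2 ?_)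
    · simpa using hp
    · simp
  · intro p hp
    rw [← sub_add_cancel p (toT k (evalT a p))]
    exact add_mem (Ideal.mem_sup_right (sub_toT_evalT_mem a p))
      (Ideal.mem_sup_left (Ideal.mem_map_of_mem _ hp))

lemma extI_sup_span_Tv (K : Ideal (MvPolynomial (Fin n) k)) :
    extI k K ⊔ Ideal.span {Tv k n} =
      K.comap (evalT (0 : MvPolynomial (Fin n) k) :
        MvPolynomial (Fin (n + 1)) k →+* MvPolynomial (Fin n) k) := by
  rw [← extI_sup_span_singleton, map_zero, sub_zero]

lemma mem_extI_of_Tv_mul_mem {K : Ideal (MvPolynomial (Fin n) k)}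
    {h : MvPolynomial (Fin (n + 1)) k} (hh : Tv k n * h ∈ extI k K) : h ∈ extI k K := by
  refine mem_span_of_X_mul_mem ?_ hh
  rintro _ ⟨p, -, rfl⟩ hv
  obtain ⟨i, -, hi⟩ := mem_vars_rename _ _ hv
  exact (Fin.castSucc_lt_last i).ne hi

/-- The substitution `T ↦ T + a` on `R[T]`. -/
def shiftT (a : MvPolynomial (Fin n) k) :
    MvPolynomial (Fin (n + 1)) k →ₐ[k] MvPolynomial (Fin (n + 1)) k :=
  aeval (Fin.lastCases (Tv k n + toT k a) fun i => X i.castSucc)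

@[simp]
lemma shiftT_toT (a p : MvPolynomial (Fin n) k) : shiftT a (toT k p) = toT k p := by
  have : (shiftT a).comp (toT k) = toT k := by
    ext i
    simp [shiftT, toT]
  exact DFunLike.congr_fun this p

@[simp]
lemma shiftT_Tv (a : MvPolynomial (Fin n) k) : shiftT a (Tv k n) = Tv k n + toT k a := by
  simp [shiftT, Tv]

lemma shiftT_neg_shiftT (a : MvPolynomial (Fin n) k) (p : MvPolynomial (Fin (n + 1)) k) :
    shiftT (-a) (shiftT a p) = p := by
  have : (shiftT (-a)).comp (shiftT a) = AlgHom.id k _ := by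
    refine MvPolynomial.algHom_ext fun i => ?_
    refine Fin.lastCases ?_ (fun i => ?_) i
    · change shiftT (-a) (shiftT a (Tv k n)) = Tv k n
      simp
    · change shiftT (-a) (shiftT a (X i.castSucc)) = X i.castSucc
      simp [shiftT]
  exact DFunLike.congr_fun this p

lemma shiftT_mem_extI {K : Ideal (MvPolynomial (Fin n) k)} (a : MvPolynomial (Fin n) k)
    {h : MvPolynomial (Fin (n + 1)) k} (hh : h ∈ extI k K) : shiftT a h ∈ extI k K := by
  have hle : extI k K ≤ (extI k K).comap (shiftT a) := by
    refine Ideal.map_le_iff_le_comap.2 fun p hp => ?_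
    rw [Ideal.mem_comap, Ideal.mem_comap, shiftT_toT]
    exact Ideal.mem_map_of_mem _ hp
  exact hle hh

lemma mem_extI_of_Tv_sub_mul_mem {K : Ideal (MvPolynomial (Fin n) k)}
    {a : MvPolynomial (Fin n) k} {h : MvPolynomial (Fin (n + 1)) k}
    (hh : (Tv k n - toT k a) * h ∈ extI k K) : h ∈ extI k K := by
  have h1 := shiftT_mem_extI a hh
  rw [map_mul, map_sub, shiftT_Tv, shiftT_toT, add_sub_cancel_right] at h1
  rw [← shiftT_neg_shiftT a h]
  exact shiftT_mem_extI _ (mem_extI_of_Tv_mul_mem h1)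

lemma Tv_mul_mem_TmulI {K : Ideal (MvPolynomial (Fin n) k)} {b : MvPolynomial (Fin (n + 1)) k}
    (hb : b ∈ extI k K) : Tv k n * b ∈ TmulI k K := by
  have hle : extI k K ≤ Submodule.comap (LinearMap.mulLeft _ (Tv k n)) (TmulI k K) := by
    refine Ideal.span_le.2 ?_
    rintro _ ⟨p, hp, rfl⟩
    exact Ideal.subset_span ⟨p, hp, rfl⟩
  exact hle hb

lemma TmulI_le_extI (K : Ideal (MvPolynomial (Fin n) k)) : TmulI k K ≤ extI k K := by
  refine Ideal.span_le.2 ?_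
  rintro _ ⟨p, hp, rfl⟩
  exact Ideal.mul_mem_left _ _ (Ideal.mem_map_of_mem _ hp)

lemma extI_sup_TmulI_eq_inf {I J : Ideal (MvPolynomial (Fin n) k)} (hIJ : I ≤ J) :
    extI k I ⊔ TmulI k J = extI k J ⊓ (extI k I ⊔ Ideal.span {Tv k n}) := by
  apply le_antisymm
  · refine sup_le (le_inf (Ideal.map_mono hIJ) le_sup_left) (le_inf (TmulI_le_extI J) ?_)
    refine le_sup_of_le_right (Ideal.span_le.2 ?_)
    rintro _ ⟨p, hp, rfl⟩
    exact Ideal.mul_mem_right _ _ (Ideal.mem_span_singleton_self _)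
  · rintro x ⟨hx, hx'⟩
    obtain ⟨a, ha, b, rfl⟩ := mem_sup_span_singleton_iff.1 hx'
    refine add_mem (Ideal.mem_sup_left ha) (Ideal.mem_sup_right (Tv_mul_mem_TmulI ?_))
    exact mem_extI_of_Tv_mul_mem ((Submodule.add_mem_iff_right _ (Ideal.map_mono hIJ ha)).1 hx)

lemma map_evalT_map_toT (a : MvPolynomial (Fin n) k) (l : List (MvPolynomial (Fin n) k)) :
    (l.map (toT k)).map (evalT a : MvPolynomial (Fin (n + 1)) k →+* MvPolynomial (Fin n) k) = l := by
  simp [Function.comp_def]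

lemma modReg_extI_cons {J : Ideal (MvPolynomial (Fin n) k)} (a : MvPolynomial (Fin n) k)
    {l : List (MvPolynomial (Fin n) k)} (h : ModReg J l) :
    ModReg (extI k J) ((Tv k n - toT k a) :: l.map (toT k)) := by
  refine ⟨fun _ => mem_extI_of_Tv_sub_mul_mem, ?_⟩
  rwa [extI_sup_span_singleton, modReg_comap_iff (evalT_surjective a), map_evalT_map_toT]

lemma modReg_extI_sup_TmulI {I J : Ideal (MvPolynomial (Fin n) k)} (hIJ : I ≤ J)
    {a : MvPolynomial (Fin n) k} {l : List (MvPolynomial (Fin n) k)} (hI : ModReg I (a :: l))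
    (hJ : ModReg J (a :: l)) (hJ' : ModReg J l) :
    ModReg (extI k I ⊔ TmulI k J) ((Tv k n - toT k a) :: l.map (toT k)) := by
  have key : ∀ K : Ideal (MvPolynomial (Fin n) k), ModReg K (a :: l) →
      ModReg (extI k K ⊔ Ideal.span {Tv k n}) ((Tv k n - toT k a) :: l.map (toT k)) := by
    intro K hK
    rw [extI_sup_span_Tv, modReg_comap_iff (evalT_surjective 0), List.map_cons, map_evalT_map_toT]
    simpa using modReg_neg_cons hK
  rw [extI_sup_TmulI_eq_inf hIJ]
  refine ModReg.inf (modReg_extI_cons a hJ') (key I hI) ?_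
  rw [← sup_assoc, sup_eq_left.2 (show extI k I ≤ extI k J from Ideal.map_mono hIJ)]
  exact key J hJ

lemma ringKrullDim_quotient_extI_sup_span_Tv_le (K : Ideal (MvPolynomial (Fin n) k)) :
    ringKrullDim (MvPolynomial (Fin (n + 1)) k ⧸ (extI k K ⊔ Ideal.span {Tv k n})) ≤
      ringKrullDim (MvPolynomial (Fin n) k ⧸ K) := by
  refine ringKrullDim_le_of_surjective (Ideal.quotientMap _ (toT k (n := n)).toRingHom ?_) ?_
  · exact fun p hp => Ideal.mem_sup_left (Ideal.mem_map_of_mem _ hp)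
  · intro y
    obtain ⟨p, rfl⟩ := Ideal.Quotient.mk_surjective y
    refine ⟨Ideal.Quotient.mk _ (evalT 0 p), ?_⟩
    have := sub_toT_evalT_mem 0 p
    rw [map_zero, sub_zero] at this
    exact ((Ideal.Quotient.mk_eq_mk_iff_sub_mem _ _).2 (Ideal.mem_sup_right this)).symm

lemma ringKrullDim_quotient_le_add_one {K : Ideal (MvPolynomial (Fin n) k)}
    {L : Ideal (MvPolynomial (Fin (n + 1)) k)} (hL : extI k K ≤ L) :
    ringKrullDim (MvPolynomial (Fin (n + 1)) k ⧸ L) ≤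
      ringKrullDim (MvPolynomial (Fin n) k ⧸ K) + 1 := by
  have hL' : K ≤ L.comap (toT k (n := n)).toRingHom :=
    fun p hp => hL (Ideal.mem_map_of_mem _ hp)
  rw [← Polynomial.ringKrullDim_of_isNoetherianRing]
  refine ringKrullDim_le_of_surjective (Polynomial.eval₂RingHom
    (Ideal.quotientMap L (toT k (n := n)).toRingHom hL')
    (Ideal.Quotient.mk L (Tv k n))) ?_
  intro y
  obtain ⟨p, rfl⟩ := Ideal.Quotient.mk_surjective y
  rw [← Set.mem_range, ← RingHom.coe_range, SetLike.mem_coe]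
  induction p using MvPolynomial.induction_on with
  | C a =>
    refine ⟨Polynomial.C (Ideal.Quotient.mk K (C a)), ?_⟩
    simp [toT]
  | add p q hp hq => rw [map_add]; exact add_mem hp hq
  | mul_X p i hp =>
    rw [map_mul]
    refine mul_mem hp ?_
    refine Fin.lastCases ?_ (fun i => ?_) i
    · exact ⟨Polynomial.X, by simp [Tv]⟩
    · exact ⟨Polynomial.C (Ideal.Quotient.mk K (X i)), by simp [toT]⟩

end AdjoinVariable

section Regular

variable {k : Type} [Field k] {ι : Type} [Fintype ι]

omit [Fintype ι] in
lemma isRegular_of_modReg {K : Ideal (MvPolynomial ι k)} (hK : ∀ p ∈ K, constantCoeff p = 0)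
    {l : List (MvPolynomial ι k)} (hl0 : ∀ b ∈ l, constantCoeff b = 0) (hl : ModReg K l) :
    RingTheory.Sequence.IsRegular (MvPolynomial ι k ⧸ K) (l.map (Ideal.Quotient.mk K)) := by
  refine ⟨(isWeaklyRegular_iff_modReg K l).2 hl, fun htop => ?_⟩
  have h1 : (Ideal.Quotient.mk K 1) ∈ (Ideal.ofList l).map (Ideal.Quotient.mk K) := by
    rw [Ideal.map_ofList]
    have : (Ideal.ofList (l.map (Ideal.Quotient.mk K)) • ⊤ :
      Submodule (MvPolynomial ι k ⧸ K) (MvPolynomial ι k ⧸ K)) =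
        Ideal.ofList (l.map (Ideal.Quotient.mk K)) := by simp
    rw [← this, ← htop]
    trivial
  rw [← Ideal.mem_comap, Ideal.comap_map_of_surjective _ Ideal.Quotient.mk_surjective,
    ← RingHom.ker_eq_comap_bot, Ideal.mk_ker] at h1
  have hle : Ideal.ofList l ⊔ K ≤ irr k ι := sup_le (Ideal.span_le.2 hl0) hK
  have := hle h1
  rw [mem_irr, map_one] at this
  exact one_ne_zero this

lemma mem_span_range_X {p : MvPolynomial ι k} (hp : constantCoeff p = 0) :
    p ∈ Ideal.span (Set.range (X : ι → MvPolynomial ι k)) := by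
  rw [← Set.image_univ, mem_ideal_span_X_image]
  intro m hm
  by_contra! h
  have hm0 : m = 0 := Finsupp.ext fun i => h i trivial
  rw [mem_support_iff, hm0] at hm
  exact hm hp

lemma depthGE_of_modReg {K : Ideal (MvPolynomial ι k)} (hK : ∀ p ∈ K, constantCoeff p = 0)
    {l : List (MvPolynomial ι k)} (hl0 : ∀ b ∈ l, constantCoeff b = 0) (hl : ModReg K l) :
    depthGE k K l.length :=
  ⟨l, rfl, fun b hb => mem_span_range_X (hl0 b hb), isRegular_of_modReg hK hl0 hl⟩

end Regular

section MonomialDescription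

variable {k : Type} [Field k] {n : ℕ}

/-- The `x`-part of an exponent vector of `R[T]`. -/
def xPart (m : Fin (n + 1) →₀ ℕ) : Fin n →₀ ℕ :=
  m.comapDomain Fin.castSucc (Fin.castSucc_injective n).injOn

@[simp]
lemma xPart_apply (m : Fin (n + 1) →₀ ℕ) (i : Fin n) : xPart m i = m i.castSucc := rfl

lemma map_castSucc_subset_support {s : Finset (Fin n)} {m : Fin (n + 1) →₀ ℕ} :
    s.map Fin.castSuccEmb ⊆ m.support ↔ s ⊆ (xPart m).support := by
  simp [Finset.subset_iff]

lemma image_toT_span_generators (S : Set (Finset (Fin n))) :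
    toT k '' {p | ∃ s, s ∈ S ∧ p = ∏ i ∈ s, X i} =
      {p | ∃ s, s ∈ Finset.map Fin.castSuccEmb '' S ∧ p = ∏ i ∈ s, X i} := by
  ext p
  constructor
  · rintro ⟨_, ⟨s, hs, rfl⟩, rfl⟩
    exact ⟨_, ⟨s, hs, rfl⟩, by simp [toT]⟩
  · rintro ⟨_, ⟨s, hs, rfl⟩, rfl⟩
    exact ⟨_, ⟨s, hs, rfl⟩, by simp [toT]⟩

lemma mem_extI_span_iff {S : Set (Finset (Fin n))} {p : MvPolynomial (Fin (n + 1)) k} :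
    p ∈ extI k (Ideal.span {p | ∃ s, s ∈ S ∧ p = ∏ i ∈ s, X i}) ↔
      ∀ m ∈ p.support, ∃ s ∈ S, s ⊆ (xPart m).support := by
  rw [extI, Ideal.map_span, image_toT_span_generators, mem_span_prod_X_iff]
  simp only [Set.exists_mem_image, map_castSucc_subset_support]

lemma mem_extI_span_sup_span_Tv_iff {S : Set (Finset (Fin n))}
    {p : MvPolynomial (Fin (n + 1)) k} :
    p ∈ extI k (Ideal.span {p | ∃ s, s ∈ S ∧ p = ∏ i ∈ s, X i}) ⊔ Ideal.span {Tv k n} ↔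
      ∀ m ∈ p.support, (∃ s ∈ S, s ⊆ (xPart m).support) ∨ m (Fin.last n) ≠ 0 := by
  have e : {p : MvPolynomial (Fin (n + 1)) k |
        ∃ s, s ∈ Finset.map Fin.castSuccEmb '' S ∧ p = ∏ i ∈ s, X i} ∪ {Tv k n} =
      {p | ∃ s, s ∈ Finset.map Fin.castSuccEmb '' S ∪ {{Fin.last n}} ∧ p = ∏ i ∈ s, X i} := by
    ext p
    simp only [Set.mem_union, Set.mem_ofPred_eq, Set.mem_singleton_iff, or_and_right, exists_or,
      exists_eq_left, Finset.prod_singleton, Tv]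
  rw [extI, Ideal.map_span, image_toT_span_generators, ← Ideal.span_union, e, mem_span_prod_X_iff]
  simp only [Set.mem_union, or_and_right, exists_or, Set.exists_mem_image,
    map_castSucc_subset_support, Set.mem_singleton_iff, exists_eq_left,
    Finset.singleton_subset_iff, Finsupp.mem_support_iff]

variable {D : SC n} {σ : Finset (Fin n)}

lemma mem_extI_sup_TmulI_iff {p : MvPolynomial (Fin (n + 1)) k} :
    p ∈ extI k (srIdeal k D) ⊔ TmulI k (linkIdeal k D σ) ↔
      ∀ m ∈ p.support, (xPart m).support ∪ σ ∉ D.faces ∧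
        ((xPart m).support ∉ D.faces ∨ m (Fin.last n) ≠ 0) := by
  have hI : srIdeal k D = Ideal.span {p | ∃ s, s ∈ {s | s ∉ D.faces} ∧ p = ∏ i ∈ s, X i} := rfl
  rw [extI_sup_TmulI_eq_inf srIdeal_le_linkIdeal, Submodule.mem_inf, linkIdeal_eq_span, hI,
    mem_extI_span_iff, mem_extI_span_sup_span_Tv_iff, ← forall₂_and]
  refine forall₂_congr fun m _ => and_congr ?_ (or_congr_left ?_)
  · constructor
    · rintro ⟨s, ⟨-, hs⟩, hsm⟩ h
      exact hs (D.down_closed _ h _ (Finset.union_subset_union_left hsm))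
    · intro h
      refine ⟨(xPart m).support \ σ, ⟨Finset.sdiff_disjoint, ?_⟩, Finset.sdiff_subset⟩
      rwa [Finset.sdiff_union_self_eq_union]
  · exact ⟨fun ⟨s, hs, hsm⟩ h => hs (D.down_closed _ h _ hsm), fun h => ⟨_, h, subset_rfl⟩⟩

lemma homI_extI_sup_TmulI (D : SC n) (σ : Finset (Fin n)) :
    HomI (extI k (srIdeal k D) ⊔ TmulI k (linkIdeal k D σ)) :=
  homI_of_forall {m | (xPart m).support ∪ σ ∉ D.faces ∧
    ((xPart m).support ∉ D.faces ∨ m (Fin.last n) ≠ 0)} fun _ => mem_extI_sup_TmulI_iff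

end MonomialDescription

section HilbertFunction

variable {k : Type} [Field k]

lemma HFq_eq_ncard {ι : Type} [Fintype ι] {K : Ideal (MvPolynomial ι k)} {P : Set (ι →₀ ℕ)}
    (hK : ∀ p, p ∈ K ↔ ∀ m ∈ p.support, m ∈ P) (m : ℕ) :
    HFq k K m = {e : ι →₀ ℕ | e.degree = m ∧ e ∉ P}.ncard := by
  classical
  set B := {e : ι →₀ ℕ | e.degree = m ∧ e ∉ P} with hB
  set f := (Ideal.Quotient.mkₐ k K).toLinearMap
  have himg : qComp k K m = (restrictSupport k B).map f := by
    apply le_antisymm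
    · rintro _ ⟨p, hp, rfl⟩
      rw [SetLike.mem_coe, homogeneousSubmodule_eq_finsupp_supported] at hp
      replace hp : ∀ e ∈ p.support, e.degree = m := fun e he => hp he
      refine ⟨∑ e ∈ p.support with e ∉ P, monomial e (p.coeff e), sum_mem fun e he => ?_, ?_⟩
      · rw [Finset.mem_filter] at he
        exact (monomial_mem_restrictSupport k).2 (Or.inl ⟨hp e he.1, he.2⟩)
      · refine (Ideal.Quotient.mk_eq_mk_iff_sub_mem _ _).2 ?_
        have hp' := (Finset.sum_filter_add_sum_filter_not p.support (fun e => e ∉ P)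
          fun e => monomial e (p.coeff e)).trans p.as_sum.symm
        rw [eq_sub_of_add_eq hp', sub_sub_cancel_left]
        refine neg_mem (sum_mem fun e he => (hK _).2 fun e' he' => ?_)
        rw [Finset.mem_filter, not_not] at he
        rw [Finset.mem_singleton.1 (support_monomial_subset he')]
        exact he.2
    · refine Submodule.map_mono fun p hp => ?_
      rw [homogeneousSubmodule_eq_finsupp_supported]
      exact fun e he => (hp he).1
  have hinj : Function.Injective (f.domRestrict (restrictSupport k B)) := by
    rw [injective_iff_map_eq_zero]
    rintro ⟨p, hp⟩ h
    have hpK : p ∈ K := Ideal.Quotient.eq_zero_iff_mem.1 h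
    rw [Submodule.mk_eq_zero, ← support_eq_empty, Finset.eq_empty_iff_forall_notMem]
    exact fun e he => (hp he).2 ((hK p).1 hpK e he)
  rw [HFq, himg, ← LinearMap.range_domRestrict, LinearMap.finrank_range_of_inj hinj,
    Module.finrank_eq_nat_card_basis (basisRestrictSupport k B)]
  rfl

lemma degree_eq_degree_xPart_add {n : ℕ} (e : Fin (n + 1) →₀ ℕ) :
    e.degree = (xPart e).degree + e (Fin.last n) := by
  rw [Finsupp.degree_eq_sum, Finsupp.degree_eq_sum, Fin.sum_univ_castSucc]
  rfl

lemma finite_degree_eq {ι : Type} [Fintype ι] (m : ℕ) (P : (ι →₀ ℕ) → Prop) :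
    {e : ι →₀ ℕ | e.degree = m ∧ P e}.Finite := by
  classical
  refine (Finset.finite_toSet (Finset.univ.finsuppAntidiag m)).subset fun e he => ?_
  simpa [← Finsupp.degree_eq_sum] using he.1

/-- The exponent vector of `R[T]` with `x`-part `e` and `T`-exponent `j`. -/
def snocT {n : ℕ} (e : Fin n →₀ ℕ) (j : ℕ) : Fin (n + 1) →₀ ℕ :=
  Finsupp.equivFunOnFinite.symm (Fin.snoc (α := fun _ => ℕ) e j)

@[simp]
lemma xPart_snocT {n : ℕ} (e : Fin n →₀ ℕ) (j : ℕ) : xPart (snocT e j) = e := by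
  ext i
  simp [snocT]

@[simp]
lemma snocT_last {n : ℕ} (e : Fin n →₀ ℕ) (j : ℕ) : snocT e j (Fin.last n) = j := by
  simp [snocT]

lemma snocT_xPart {n : ℕ} (e : Fin (n + 1) →₀ ℕ) : snocT (xPart e) (e (Fin.last n)) = e := by
  ext i
  refine Fin.lastCases ?_ (fun i => ?_) i <;> simp [snocT]

lemma ncard_degree_eq_sum {n : ℕ} (m : ℕ) (P : ℕ → (Fin n →₀ ℕ) → Prop) :
    {e : Fin (n + 1) →₀ ℕ | e.degree = m ∧ P (e (Fin.last n)) (xPart e)}.ncard =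
      ∑ j ∈ Finset.range (m + 1), {e : Fin n →₀ ℕ | e.degree = m - j ∧ P j e}.ncard := by
  classical
  have hfin := finite_degree_eq m fun e : Fin (n + 1) →₀ ℕ => P (e (Fin.last n)) (xPart e)
  rw [Set.ncard_eq_toFinset_card _ hfin,
    Finset.card_eq_sum_card_fiberwise (f := fun e => e (Fin.last n)) (t := Finset.range (m + 1))]
  · refine Finset.sum_congr rfl fun j hj => ?_
    rw [Finset.mem_range] at hj
    rw [← Set.ncard_coe_finset]
    refine Set.ncard_congr (fun e _ => xPart e) ?_ ?_ ?_
    · intro e he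
      simp only [Finset.coe_filter, Set.Finite.mem_toFinset, Set.mem_ofPred_eq] at he
      obtain ⟨⟨h1, h2⟩, rfl⟩ := he
      rw [degree_eq_degree_xPart_add] at h1
      exact ⟨by omega, h2⟩
    · intro e e' he he' h
      simp only [Finset.coe_filter, Set.Finite.mem_toFinset, Set.mem_ofPred_eq] at he he'
      rw [← snocT_xPart e, ← snocT_xPart e', h, he.2, he'.2]
    · rintro e ⟨h1, h2⟩
      refine ⟨snocT e j, ?_, xPart_snocT e j⟩
      simp only [Finset.coe_filter, Set.Finite.mem_toFinset, Set.mem_ofPred_eq, xPart_snocT,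
        snocT_last, degree_eq_degree_xPart_add, h2, and_true]
      omega
  · intro e he
    simp only [Set.Finite.coe_toFinset, Set.mem_ofPred_eq] at he
    have := degree_eq_degree_xPart_add e
    simp only [Finset.coe_range, Set.mem_Iio]
    omega

lemma HFq_extI_sup_TmulI {n : ℕ} (D : SC n) (σ : Finset (Fin n)) (m : ℕ) :
    HFq k (extI k (srIdeal k D) ⊔ TmulI k (linkIdeal k D σ)) m =
      HFq k (srIdeal k D) m + ∑ j ∈ Finset.Icc 1 m, HFq k (linkIdeal k D σ) (m - j) := by
  have hD : ∀ s : Finset (Fin n), s ∪ σ ∈ D.faces → s ∈ D.faces := fun s h =>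
    D.down_closed _ h _ Finset.subset_union_left
  simp only [HFq_eq_ncard (P := {m | m.support ∪ σ ∉ D.faces}) (fun _ => mem_linkIdeal_iff),
    HFq_eq_ncard (P := {m | m.support ∉ D.faces}) (fun _ => mem_srIdeal_iff),
    HFq_eq_ncard (P := {m | (xPart m).support ∪ σ ∉ D.faces ∧
      ((xPart m).support ∉ D.faces ∨ m (Fin.last n) ≠ 0)}) (fun _ => mem_extI_sup_TmulI_iff)]
  refine (ncard_degree_eq_sum m fun j e =>
    ¬ (e.support ∪ σ ∉ D.faces ∧ (e.support ∉ D.faces ∨ j ≠ 0))).trans ?_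
  rw [Finset.range_eq_Ico, Finset.sum_eq_sum_Ico_succ_bot (Nat.succ_pos m)]
  congr 1
  · congr 1
    ext e
    have := hD e.support
    simp only [Set.mem_ofPred_eq]
    tauto
  · refine Finset.sum_congr rfl fun j hj => ?_
    have hj : j ≠ 0 := by
      have := (Finset.mem_Ico.1 hj).1
      omega
    simp [hj]

end HilbertFunction

section StructureOfIQ

variable {k : Type} [Field k] {n : ℕ} {D : SC n} {σ : Finset (Fin n)}

lemma constantCoeff_toT (p : MvPolynomial (Fin n) k) :
    constantCoeff (toT k p) = constantCoeff p :=
  constantCoeff_rename _ _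

lemma constantCoeff_Tv_sub_toT {a : MvPolynomial (Fin n) k} (ha : constantCoeff a = 0) :
    constantCoeff (Tv k n - toT k a) = 0 := by
  rw [map_sub, constantCoeff_toT, ha, Tv, constantCoeff_X, sub_zero]

lemma constantCoeff_linForm (c : Fin n → k) : constantCoeff (linForm k c) = 0 := by
  simp [linForm]

lemma constantCoeff_of_mem_extI {K : Ideal (MvPolynomial (Fin n) k)}
    (hK : ∀ p ∈ K, constantCoeff p = 0) {p : MvPolynomial (Fin (n + 1)) k} (hp : p ∈ extI k K) :
    constantCoeff p = 0 := by
  have hle : extI k K ≤ irr k (Fin (n + 1)) := Ideal.map_le_iff_le_comap.2 fun p hp =>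
    (constantCoeff_toT p).trans (hK p hp)
  exact hle hp

lemma extI_sup_TmulI_le_extI (D : SC n) (σ : Finset (Fin n)) :
    extI k (srIdeal k D) ⊔ TmulI k (linkIdeal k D σ) ≤ extI k (linkIdeal k D σ) :=
  sup_le (Ideal.map_mono srIdeal_le_linkIdeal) (TmulI_le_extI _)

lemma constantCoeff_of_mem_extI_sup_TmulI (hσ : σ ∈ D.faces) {p : MvPolynomial (Fin (n + 1)) k}
    (hp : p ∈ extI k (srIdeal k D) ⊔ TmulI k (linkIdeal k D σ)) : constantCoeff p = 0 :=
  constantCoeff_of_mem_extI (fun _ => constantCoeff_of_mem_linkIdeal hσ)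
    (extI_sup_TmulI_le_extI D σ hp)

lemma le_ringKrullDim_quotient_extI_sup_TmulI (hσ : σ ∈ D.faces)
    {l : List (MvPolynomial (Fin n) k)} (hl0 : ∀ b ∈ l, constantCoeff b = 0)
    (hl : ModReg (linkIdeal k D σ) l) :
    ((l.length + 1 : ℕ) : WithBot ℕ∞) ≤ ringKrullDim (MvPolynomial (Fin (n + 1)) k ⧸
      (extI k (srIdeal k D) ⊔ TmulI k (linkIdeal k D σ))) := by
  have h := length_le_ringKrullDim_quotient (z := 1) (modReg_extI_cons 0 hl) ?_ ?_
    (I := extI k (linkIdeal k D σ)) ?_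
  · rw [List.length_cons, List.length_map] at h
    exact h.trans (ringKrullDim_le_of_surjective
      (Ideal.Quotient.factor (extI_sup_TmulI_le_extI D σ)) (Ideal.Quotient.factor_surjective _))
  · simp only [List.mem_cons, List.mem_map]
    rintro _ (rfl | ⟨b, hb, rfl⟩)
    · exact constantCoeff_Tv_sub_toT (map_zero _)
    · rw [constantCoeff_toT, hl0 b hb]
  · intro s hs hs'
    rw [mul_one] at hs'
    exact hs (constantCoeff_of_mem_extI (fun _ => constantCoeff_of_mem_linkIdeal hσ) hs')
  · intro a ha
    rwa [mul_one]

/-- A monomial supported on a face `τ` with `τ ∪ σ` not a face is killed by `T` modulo `I_Q`,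
which bounds the depth by the dimension of `k[D]`. -/
lemma length_le_ringKrullDim_of_modReg_extI_sup_TmulI {τ : Finset (Fin n)} (hτ : τ ∈ D.faces)
    (hτσ : τ ∪ σ ∉ D.faces) {l : List (MvPolynomial (Fin (n + 1)) k)}
    (hl0 : ∀ b ∈ l, constantCoeff b = 0)
    (hl : ModReg (extI k (srIdeal k D) ⊔ TmulI k (linkIdeal k D σ)) l) :
    (l.length : WithBot ℕ∞) ≤ ringKrullDim (MvPolynomial (Fin n) k ⧸ srIdeal k D) := by
  classical
  set e : Fin n →₀ ℕ := Finsupp.indicator τ fun _ _ => 1 with he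
  have hsupp : e.support = τ := by
    ext i
    simp [he, Finsupp.indicator_apply]
  have hJ : monomial e 1 ∈ linkIdeal k D σ := mem_linkIdeal_iff.2 fun m hm => by
    rwa [Finset.mem_singleton.1 (support_monomial_subset hm), hsupp]
  have hI : monomial e 1 ∉ srIdeal k D := fun h =>
    mem_srIdeal_iff.1 h e (by simp [mem_support_iff]) (hsupp ▸ hτ)
  refine (length_le_ringKrullDim_quotient (z := toT k (monomial e 1))
    (I := extI k (srIdeal k D) ⊔ Ideal.span {Tv k n}) hl hl0 ?_ ?_).trans
    (ringKrullDim_quotient_extI_sup_span_Tv_le _)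
  · intro s hs hsz
    have hz := (homI_extI_sup_TmulI D σ).mem_of_mul_mem hs hsz
    rw [extI_sup_TmulI_eq_inf srIdeal_le_linkIdeal, extI_sup_span_Tv] at hz
    have := hz.2
    rw [SetLike.mem_coe, Ideal.mem_comap] at this
    exact hI (by simpa using this)
  · intro a ha
    obtain ⟨a, ha', b, rfl⟩ := mem_sup_span_singleton_iff.1 ha
    rw [add_mul, mul_assoc]
    exact add_mem (Ideal.mem_sup_left (Ideal.mul_mem_right _ _ ha'))
      (Ideal.mem_sup_right (Tv_mul_mem_TmulI (Ideal.mul_mem_left _ _ (Ideal.mem_map_of_mem _ hJ))))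

lemma modReg_extI_sup_TmulI_linForm (hD : depthGE k (srIdeal k D) (dimP D))
    {g : MvPolynomial (Fin (dimP D) × Fin n) k}
    (hg : ∀ c, eval c g ≠ 0 → artGor k (redIdeal k (srIdeal k D) c))
    {c : Fin (dimP D + 1) × Fin n → k}
    (hc : eval c (rename (Prod.map Fin.castSucc id) g * rename (Prod.map Fin.succ id) g) ≠ 0)
    {t : ℕ} (ht : 1 ≤ t) (htd : t ≤ dimP D) :
    ModReg (extI k (srIdeal k D) ⊔ TmulI k (linkIdeal k D σ))
      ((Tv k n - toT k (linForm k fun i => c (0, i))) :: List.ofFn fun j : Fin (t - 1) =>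
        toT k (linForm k fun i => c (⟨(j : ℕ) + 1, by omega⟩, i))) := by
  rw [map_mul, eval_rename, eval_rename] at hc
  have h₁ := (hg _ (left_ne_zero_of_mul hc)).1
  have h₂ := (hg _ (right_ne_zero_of_mul hc)).1
  have e₁ : linForm k (fun i => c (0, i)) :: (List.ofFn fun j : Fin (t - 1) =>
      linForm k fun i => c (⟨(j : ℕ) + 1, by omega⟩, i)) =
      (List.ofFn fun j : Fin (dimP D) => linForm k fun i =>
        (c ∘ Prod.map Fin.castSucc id) (j, i)).take t := by
    refine List.ext_getElem (by simp; omega) fun j hj _ => ?_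
    cases j with
    | zero => simp
    | succ j => simp
  have e₂ : (List.ofFn fun j : Fin (t - 1) =>
      linForm k fun i => c (⟨(j : ℕ) + 1, by omega⟩, i)) =
      (List.ofFn fun j : Fin (dimP D) => linForm k fun i =>
        (c ∘ Prod.map Fin.succ id) (j, i)).take (t - 1) := by
    refine List.ext_getElem (by simp; omega) fun j hj _ => ?_
    simp
  have := modReg_extI_sup_TmulI srIdeal_le_linkIdeal (a := linForm k fun i => c (0, i))
    (e₁ ▸ (modReg_srIdeal hD h₁).take t) (e₁ ▸ (modReg_linkIdeal (σ := σ) hD h₁).take t)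
    (e₂ ▸ (modReg_linkIdeal (σ := σ) hD h₂).take (t - 1))
  rwa [List.map_ofFn] at this

lemma constantCoeff_of_mem_cons_linForm {t : ℕ} {f : Fin n → k} {g : Fin t → Fin n → k}
    {b : MvPolynomial (Fin (n + 1)) k}
    (hb : b ∈ (Tv k n - toT k (linForm k f)) :: List.ofFn fun j => toT k (linForm k (g j))) :
    constantCoeff b = 0 := by
  rw [List.mem_cons, List.mem_ofFn] at hb
  rcases hb with rfl | ⟨j, rfl⟩
  · exact constantCoeff_Tv_sub_toT (constantCoeff_linForm _)
  · rw [constantCoeff_toT, constantCoeff_linForm]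

lemma exists_eval_ne_zero {ι : Type} [Infinite k] {g : MvPolynomial ι k} (hg : g ≠ 0) :
    ∃ c, eval c g ≠ 0 := by
  by_contra! h
  exact hg (MvPolynomial.funext fun c => by rw [h c, map_zero])

end StructureOfIQ

/-- **Proposition (properties of `I_Q = (I, T·I_L)`).** (i) `dim R[T]/I_Q = d+1` and
`depth R[T]/I_Q = d`; (ii) `HF(m, R[T]/I_Q) = HF(m,k[D]) + ∑_{j=1}^m HF(m-j, R/I_L)`;
(iii) for `1 ≤ t ≤ d` and general linear forms, `T - f₁, f₂, …, f_t` is an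
`R[T]/I_Q`-regular sequence. -/
theorem structure_of_IQ (k : Type) [Field k] [Infinite k]
    (n q d : ℕ) (hq : 1 ≤ q)
    (D : SC n) (hD : gorStar k D)
    (σ : Finset (Fin n)) (hσ : σ ∈ D.faces) (hcard : σ.card = q + 1)
    (hd : d = dimP D) :
    ringKrullDim (MvPolynomial (Fin (n + 1)) k ⧸
        (extI k (srIdeal k D) ⊔ TmulI k (linkIdeal k D σ))) = ((d + 1 : ℕ) : ℕ) ∧
    depthGE k (extI k (srIdeal k D) ⊔ TmulI k (linkIdeal k D σ)) d ∧
    ¬ depthGE k (extI k (srIdeal k D) ⊔ TmulI k (linkIdeal k D σ)) (d + 1) ∧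
    (∀ m : ℕ, HFq k (extI k (srIdeal k D) ⊔ TmulI k (linkIdeal k D σ)) m =
      HFq k (srIdeal k D) m +
        ∑ j ∈ Finset.Icc 1 m, HFq k (linkIdeal k D σ) (m - j)) ∧
    (Generic k (Fin (d + 1) × Fin n) fun c => ∀ (t : ℕ) (_ht : 1 ≤ t) (_htd : t ≤ d),
      RingTheory.Sequence.IsRegular
        (MvPolynomial (Fin (n + 1)) k ⧸
          (extI k (srIdeal k D) ⊔ TmulI k (linkIdeal k D σ)))
        (((Tv k n - toT k (linForm k fun i => c (0, i))) ::
            List.ofFn fun j : Fin (t - 1) =>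
              toT k (linForm k fun i => c (⟨(j : ℕ) + 1, by omega⟩, i))).map
          (Ideal.Quotient.mk
            (extI k (srIdeal k D) ⊔ TmulI k (linkIdeal k D σ))))) := by
  subst hd
  obtain ⟨-, ⟨⟨hdim, hdepth⟩, g, hg0, hg⟩, hstar⟩ := hD
  have hd : 1 ≤ dimP D := by
    have : σ.card ≤ dimP D := Finset.le_sup (f := Finset.card) hσ
    omega
  have hcc : ∀ p ∈ extI k (srIdeal k D) ⊔ TmulI k (linkIdeal k D σ), constantCoeff p = 0 :=
    fun _ => constantCoeff_of_mem_extI_sup_TmulI hσ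
  have hG0 : rename (Prod.map Fin.castSucc id) g * rename (Prod.map Fin.succ id) g ≠ 0 := by
    refine mul_ne_zero ?_ ?_
    · rwa [Ne, map_eq_zero_iff _ (rename_injective _
        ((Fin.castSucc_injective _).prodMap Function.injective_id))]
    · rwa [Ne, map_eq_zero_iff _ (rename_injective _
        ((Fin.succ_injective _).prodMap Function.injective_id))]
  refine ⟨le_antisymm ?_ ?_, ?_, fun h => ?_, HFq_extI_sup_TmulI D σ, _, hG0,
    fun c hc t ht htd => isRegular_of_modReg hcc (fun b => constantCoeff_of_mem_cons_linForm)
      (modReg_extI_sup_TmulI_linForm hdepth hg hc ht htd)⟩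
  · refine (ringKrullDim_quotient_le_add_one le_sup_left).trans ?_
    rw [hdim]
    exact le_of_eq (by push_cast; rfl)
  · obtain ⟨c, hc⟩ := exists_eval_ne_zero hg0
    obtain ⟨l, hlen, hl0, hl⟩ := exists_modReg_linkIdeal (σ := σ) hdepth (hg c hc).1
    rw [← hlen]
    exact le_ringKrullDim_quotient_extI_sup_TmulI hσ hl0 hl
  · obtain ⟨c, hc⟩ := exists_eval_ne_zero hG0
    have := depthGE_of_modReg hcc (fun b => constantCoeff_of_mem_cons_linForm)
      (modReg_extI_sup_TmulI_linForm hdepth hg hc hd le_rfl)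
    rwa [List.length_cons, List.length_ofFn, Nat.sub_add_cancel hd] at this
  · obtain ⟨l, hlen, hl0, hl⟩ := exists_modReg_of_depthGE h
    obtain ⟨i, hi⟩ : σ.Nonempty := Finset.card_pos.1 (by omega)
    obtain ⟨τ, hτ, hiτ⟩ := hstar i
    have hτσ : τ ∪ σ ∉ D.faces := fun h => hiτ (D.down_closed _ h _
      (Finset.insert_subset (Finset.mem_union_right _ hi) Finset.subset_union_left))
    have := length_le_ringKrullDim_of_modReg_extI_sup_TmulI hτ hτσ hl0 hl
    rw [hdim, hlen] at this
    have := Nat.cast_le.1 this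
    omega

end SRWLP
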